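/- Fix d ≥ 1, let P ⊆ EuclideanSpace ℝ (Fin (d+1)) be a convex polytope with nonempty interior, let S = frontier P, and let v ∈ S be a source point lying in the relative interior of a face of P of dimension d. Then the cut locus, i.e., the closure in S of the set K_v of cut points, equals K_v ∪ S_{d−2}, the union of the set of cut points and the set of warped points. (Corollary 2.6, part 2, of the paper.) -/

import Mathlib

open scoped RealInnerProductSpace ENNReal

/-- A path in `S` from `a` to `b`: a continuous map `γ` on `[0,1]` with
`γ 0 = a`, `γ 1 = b`, and image contained in `S`. -/
def IsPathIn {E : Type*} [NormedAddCommGroup E] [InnerProductSpace ℝ E]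
    (S : Set E) (a b : E) (γ : ℝ → E) : Prop :=
  ContinuousOn γ (Set.Icc 0 1) ∧ γ 0 = a ∧ γ 1 = b ∧ Set.MapsTo γ (Set.Icc 0 1) S

/-- The length of a path: its total variation on `[0,1]`. -/
noncomputable def pathLength {E : Type*} [NormedAddCommGroup E] [InnerProductSpace ℝ E]
    (γ : ℝ → E) : ℝ≥0∞ :=
  eVariationOn γ (Set.Icc 0 1)

/-- The intrinsic distance in `S`: the infimum of lengths of paths in `S`
from `a` to `b`. -/
noncomputable def intrinsicDist {E : Type*} [NormedAddCommGroup E] [InnerProductSpace ℝ E]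
    (S : Set E) (a b : E) : ℝ≥0∞ :=
  ⨅ (γ : ℝ → E) (_ : IsPathIn S a b γ), pathLength γ

/-- A shortest path in `S` from `a` to `b`: a path in `S` from `a` to `b` whose
length equals the intrinsic distance `μ(a,b)`. -/
def IsShortestPath {E : Type*} [NormedAddCommGroup E] [InnerProductSpace ℝ E]
    (S : Set E) (a b : E) (γ : ℝ → E) : Prop :=
  IsPathIn S a b γ ∧ pathLength γ = intrinsicDist S a b

/-- A face of `P`: a nonempty convex subset of `P` that is extreme in `P`. -/
def IsFace {E : Type*} [NormedAddCommGroup E] [InnerProductSpace ℝ E]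
    (P F : Set E) : Prop :=
  F.Nonempty ∧ Convex ℝ F ∧ IsExtreme ℝ P F

/-- The dimension of a face: the dimension of its affine span. -/
noncomputable def faceDim {E : Type*} [NormedAddCommGroup E] [InnerProductSpace ℝ E]
    (F : Set E) : ℕ :=
  Module.finrank ℝ (affineSpan ℝ F).direction

/-- A point `x` is a cut point for the source `v` on `frontier P` if there are
two shortest paths in `frontier P` from `v` to `x` with distinct images. -/
def IsCutPoint {E : Type*} [NormedAddCommGroup E] [InnerProductSpace ℝ E]
    (P : Set E) (v x : E) : Prop :=
  ∃ γ₁ γ₂ : ℝ → E,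
    IsShortestPath (frontier P) v x γ₁ ∧ IsShortestPath (frontier P) v x γ₂ ∧
      γ₁ '' Set.Icc 0 1 ≠ γ₂ '' Set.Icc 0 1

namespace CutLocus

open Set Filter Topology Metric

section IntrinsicDistance

theorem eVariationOn_le_of_lipschitz {E : Type*} [SeminormedAddCommGroup E] {γ : ℝ → E} {K : ℝ}
    {a b : ℝ} (hab : a ≤ b)
    (h : ∀ s ∈ Icc a b, ∀ t ∈ Icc a b, ‖γ s - γ t‖ ≤ K * |s - t|) :
    eVariationOn γ (Icc a b) ≤ ENNReal.ofReal (K * (b - a)) := by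
  rcases hab.eq_or_lt with rfl | hlt
  · rw [eVariationOn.subsingleton _ (by simp)]; simp
  have hK : 0 ≤ K := by
    have := (norm_nonneg _).trans (h a (left_mem_Icc.2 hab) b (right_mem_Icc.2 hab))
    exact nonneg_of_mul_nonneg_left this (abs_pos.2 (by linarith))
  have hL : LipschitzOnWith K.toNNReal γ (Icc a b) := by
    refine LipschitzOnWith.of_dist_le_mul fun s hs t ht => ?_
    rw [dist_eq_norm, Real.dist_eq, Real.coe_toNNReal _ hK]
    exact h s hs t ht
  have h1 := hL.comp_eVariationOn_le (g := (id : ℝ → ℝ)) (s := Icc a b) (fun x hx => hx)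
  have h2 : eVariationOn (id : ℝ → ℝ) (Icc a b) ≤ ENNReal.ofReal (b - a) := by
    have := (monotoneOn_id (s := Icc a b)).eVariationOn_eq (left_mem_Icc.2 hab)
      (right_mem_Icc.2 hab)
    rw [inter_self] at this
    exact this.le
  rw [Function.comp_id] at h1
  refine h1.trans ?_
  rw [ENNReal.ofReal_mul hK]
  gcongr
  rfl

variable {E : Type*} [NormedAddCommGroup E] [InnerProductSpace ℝ E] {S : Set E}

theorem intrinsicDist_le_eVariationOn {γ : ℝ → E} {s t : ℝ} (hst : s ≤ t)
    (hc : ContinuousOn γ (Icc s t)) (hS : MapsTo γ (Icc s t) S) :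
    intrinsicDist S (γ s) (γ t) ≤ eVariationOn γ (Icc s t) := by
  set φ : ℝ → ℝ := fun u => s + u * (t - s) with hφ
  have hm : MapsTo φ (Icc 0 1) (Icc s t) := by
    rintro u ⟨h0, h1⟩
    constructor <;> simp only [hφ] <;> nlinarith
  have hmono : MonotoneOn φ (Icc 0 1) := by
    intro u _ w _ huw
    simp only [hφ]
    nlinarith
  refine (iInf₂_le (γ ∘ φ) ⟨hc.comp (by fun_prop) hm, by simp [hφ], by simp [hφ], hS.comp hm⟩).trans
    ?_
  exact eVariationOn.comp_le_of_monotoneOn γ φ hmono hm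

theorem edist_le_intrinsicDist (a b : E) : edist a b ≤ intrinsicDist S a b := by
  refine le_iInf₂ fun γ hγ => ?_
  have := eVariationOn.edist_le γ (s := Icc 0 1) (x := 0) (y := 1) (by simp) (by simp)
  rwa [hγ.2.1, hγ.2.2.1] at this

theorem intrinsicDist_comm_le (a b : E) : intrinsicDist S a b ≤ intrinsicDist S b a := by
  refine le_iInf₂ fun γ hγ => ?_
  have hm : MapsTo (fun u : ℝ => 1 - u) (Icc 0 1) (Icc 0 1) := by
    rintro u ⟨h0, h1⟩
    constructor <;> simp only <;> linarith
  refine (iInf₂_le (γ ∘ fun u => 1 - u)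
    ⟨hγ.1.comp (by fun_prop) hm, by simp [hγ.2.2.1], by simp [hγ.2.1], hγ.2.2.2.comp hm⟩).trans ?_
  exact eVariationOn.comp_le_of_antitoneOn γ _ (fun u _ w _ h => sub_le_sub_left h 1) hm

theorem intrinsicDist_comm (a b : E) : intrinsicDist S a b = intrinsicDist S b a :=
  le_antisymm (intrinsicDist_comm_le a b) (intrinsicDist_comm_le b a)

theorem intrinsicDist_triangle (a b c : E) :
    intrinsicDist S a c ≤ intrinsicDist S a b + intrinsicDist S b c := by
  have key : ∀ γ₁ γ₂ : ℝ → E, IsPathIn S a b γ₁ → IsPathIn S b c γ₂ →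
      intrinsicDist S a c ≤ pathLength γ₁ + pathLength γ₂ := by
    intro γ₁ γ₂ h₁ h₂
    set γ : ℝ → E := fun t => if t ≤ 1 then γ₁ t else γ₂ (t - 1) with hγ
    have e1 : EqOn γ γ₁ (Icc 0 1) := fun t ht => by simp [hγ, ht.2]
    have e2 : EqOn γ (fun t => γ₂ (t - 1)) (Icc 1 2) := by
      intro t ht
      rcases ht.1.eq_or_lt with rfl | h
      · simp [hγ, h₁.2.2.1, h₂.2.1]
      · simp [hγ, not_le.2 h]
    have m2 : MapsTo (fun t : ℝ => t - 1) (Icc 1 2) (Icc 0 1) := by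
      rintro u ⟨h0, h1⟩
      constructor <;> simp only <;> linarith
    have hU : Icc (0 : ℝ) 2 = Icc 0 1 ∪ Icc 1 2 :=
        (Icc_union_Icc_eq_Icc (by norm_num) (by norm_num)).symm
    have hc : ContinuousOn γ (Icc 0 2) := by
      rw [hU]
      refine ContinuousOn.union_of_isClosed ?_ ?_ isClosed_Icc isClosed_Icc
      · exact h₁.1.congr e1
      · exact (h₂.1.comp (by fun_prop) m2).congr e2
    have hS : MapsTo γ (Icc 0 2) S := by
      rw [hU]
      rintro t (ht | ht)
      · rw [e1 ht]; exact h₁.2.2.2 ht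
      · rw [e2 ht]; exact h₂.2.2.2 (m2 ht)
    have h := intrinsicDist_le_eVariationOn (by norm_num : (0 : ℝ) ≤ 2) hc hS
    have h0 : γ 0 = a := by rw [e1 (by simp)]; exact h₁.2.1
    have h2 : γ 2 = c := by rw [e2 (by norm_num)]; norm_num; exact h₂.2.2.1
    rw [h0, h2] at h
    refine h.trans ?_
    have hadd := eVariationOn.Icc_add_Icc γ (s := univ) (a := (0 : ℝ)) (b := 1) (c := 2)
      (by norm_num) (by norm_num) (mem_univ _)
    simp only [univ_inter] at hadd
    rw [← hadd, eVariationOn.congr e1, eVariationOn.congr e2]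
    refine add_le_add le_rfl ?_
    exact eVariationOn.comp_le_of_monotoneOn γ₂ _ (fun u _ w _ h => sub_le_sub_right h 1) m2
  unfold intrinsicDist at key ⊢
  rw [ENNReal.iInf_add]
  refine le_iInf fun γ₁ => ?_
  rw [ENNReal.iInf_add]
  refine le_iInf fun h₁ => ?_
  rw [ENNReal.add_iInf]
  refine le_iInf fun γ₂ => ?_
  rw [ENNReal.add_iInf]
  refine le_iInf fun h₂ => ?_
  exact key γ₁ γ₂ h₁ h₂

theorem intrinsicDist_le_of_segment_subset {a b : E} (h : segment ℝ a b ⊆ S) :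
    intrinsicDist S a b ≤ ENNReal.ofReal ‖a - b‖ := by
  have hm : MapsTo (AffineMap.lineMap a b : ℝ → E) (Icc 0 1) S := by
    intro t ht
    apply h
    rw [segment_eq_image_lineMap]
    exact mem_image_of_mem _ ht
  have h1 := intrinsicDist_le_eVariationOn (γ := (AffineMap.lineMap a b : ℝ → E)) zero_le_one
    (AffineMap.lineMap_continuous.continuousOn) hm
  rw [AffineMap.lineMap_apply_zero, AffineMap.lineMap_apply_one] at h1
  refine h1.trans ?_
  have h2 := eVariationOn_le_of_lipschitz (γ := (AffineMap.lineMap a b : ℝ → E)) (K := ‖a - b‖)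
    zero_le_one (fun s _ t _ => by
      rw [← dist_eq_norm, dist_lineMap_lineMap, Real.dist_eq, dist_eq_norm, mul_comm])
  simpa using h2

/-- A compact connected set which is star-shaped near each of its points. -/
structure IsConicSurface (S : Set E) : Prop where
  isCompact : IsCompact S
  isPreconnected : IsPreconnected S
  exists_segment_subset : ∀ z ∈ S, ∃ r > 0, ∀ x ∈ S, ‖x - z‖ < r → segment ℝ z x ⊆ S

theorem IsConicSurface.intrinsicDist_lt_top (hS : IsConicSurface S) {a b : E} (ha : a ∈ S)
    (hb : b ∈ S) : intrinsicDist S a b < ∞ := by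
  have hloc : ∀ z ∈ S, ∃ r > 0, ∀ x ∈ S, ‖x - z‖ < r → intrinsicDist S z x < ∞ := by
    intro z hz
    obtain ⟨r, hr, h⟩ := hS.exists_segment_subset z hz
    exact ⟨r, hr, fun x hx hxz =>
      (intrinsicDist_le_of_segment_subset (h x hx hxz)).trans_lt ENNReal.ofReal_lt_top⟩
  by_contra hcon
  choose! r hr hloc using hloc
  set U : Set E := ⋃ z ∈ {z ∈ S | intrinsicDist S a z < ∞}, ball z (r z)
  set V : Set E := ⋃ z ∈ {z ∈ S | ¬ intrinsicDist S a z < ∞}, ball z (r z)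
  have hU : IsOpen U := isOpen_biUnion fun _ _ => isOpen_ball
  have hV : IsOpen V := isOpen_biUnion fun _ _ => isOpen_ball
  have haU : a ∈ U := by
    refine mem_iUnion₂.2 ⟨a, ⟨ha, ?_⟩, mem_ball_self (hr a ha)⟩
    exact hloc a ha a ha (by simpa using hr a ha)
  have hbV : b ∈ V := mem_iUnion₂.2 ⟨b, ⟨hb, hcon⟩, mem_ball_self (hr b hb)⟩
  obtain ⟨x, hxS, hxU, hxV⟩ := hS.isPreconnected U V hU hV (fun z hz => by
    by_cases h : intrinsicDist S a z < ∞
    · exact Or.inl (mem_iUnion₂.2 ⟨z, ⟨hz, h⟩, mem_ball_self (hr z hz)⟩)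
    · exact Or.inr (mem_iUnion₂.2 ⟨z, ⟨hz, h⟩, mem_ball_self (hr z hz)⟩)) ⟨a, ha, haU⟩ ⟨b, hb, hbV⟩
  obtain ⟨z, ⟨hz, hz1⟩, hxz⟩ := mem_iUnion₂.1 hxU
  obtain ⟨w, ⟨hw, hw1⟩, hxw⟩ := mem_iUnion₂.1 hxV
  rw [mem_ball, dist_eq_norm] at hxz hxw
  apply hw1
  have h1 := hloc z hz x hxS hxz
  have h2 := hloc w hw x hxS hxw
  rw [intrinsicDist_comm] at h2
  exact (intrinsicDist_triangle a x w).trans_lt (ENNReal.add_lt_top.2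
    ⟨(intrinsicDist_triangle a z x).trans_lt (ENNReal.add_lt_top.2 ⟨hz1, h1⟩), h2⟩)

/-- The intrinsic distance as a real number. -/
noncomputable def surfDist (S : Set E) (a b : E) : ℝ := (intrinsicDist S a b).toReal

theorem surfDist_nonneg (a b : E) : 0 ≤ surfDist S a b := ENNReal.toReal_nonneg

theorem surfDist_comm (a b : E) : surfDist S a b = surfDist S b a := by
  rw [surfDist, intrinsicDist_comm, surfDist]

namespace IsConicSurface

variable (hS : IsConicSurface S) {a b c : E}
include hS

theorem ofReal_surfDist (ha : a ∈ S) (hb : b ∈ S) :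
    ENNReal.ofReal (surfDist S a b) = intrinsicDist S a b :=
  ENNReal.ofReal_toReal (hS.intrinsicDist_lt_top ha hb).ne

theorem surfDist_triangle (ha : a ∈ S) (hb : b ∈ S) (hc : c ∈ S) :
    surfDist S a c ≤ surfDist S a b + surfDist S b c := by
  rw [surfDist, surfDist, surfDist, ← ENNReal.toReal_add (hS.intrinsicDist_lt_top ha hb).ne
    (hS.intrinsicDist_lt_top hb hc).ne]
  exact ENNReal.toReal_mono (ENNReal.add_ne_top.2 ⟨(hS.intrinsicDist_lt_top ha hb).ne,
    (hS.intrinsicDist_lt_top hb hc).ne⟩) (intrinsicDist_triangle a b c)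

theorem norm_sub_le_surfDist (ha : a ∈ S) (hb : b ∈ S) : ‖a - b‖ ≤ surfDist S a b := by
  have h := edist_le_intrinsicDist (S := S) a b
  rw [← hS.ofReal_surfDist ha hb, edist_dist, dist_eq_norm] at h
  exact (ENNReal.ofReal_le_ofReal_iff (surfDist_nonneg a b)).1 h

theorem surfDist_eq_of_segment_subset (h : segment ℝ a b ⊆ S) : surfDist S a b = ‖a - b‖ := by
  have ha := h (left_mem_segment ℝ a b)
  have hb := h (right_mem_segment ℝ a b)
  refine le_antisymm ?_ (hS.norm_sub_le_surfDist ha hb)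
  have := intrinsicDist_le_of_segment_subset h
  rw [← hS.ofReal_surfDist ha hb] at this
  exact (ENNReal.ofReal_le_ofReal_iff (norm_nonneg _)).1 this

theorem surfDist_self (ha : a ∈ S) : surfDist S a a = 0 := by
  rw [hS.surfDist_eq_of_segment_subset (by simpa using ha)]; simp

theorem eq_of_surfDist_le_zero (ha : a ∈ S) (hb : b ∈ S) (h : surfDist S a b ≤ 0) : a = b := by
  have := hS.norm_sub_le_surfDist ha hb
  exact sub_eq_zero.1 (norm_le_zero_iff.1 (this.trans h))

theorem exists_surfDist_eq (ha : a ∈ S) :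
    ∃ r > 0, ∀ x ∈ S, ‖x - a‖ < r → surfDist S a x = ‖a - x‖ := by
  obtain ⟨r, hr, h⟩ := hS.exists_segment_subset a ha
  exact ⟨r, hr, fun x hx hxa => hS.surfDist_eq_of_segment_subset (h x hx hxa)⟩

theorem continuous_surfDist : Continuous fun p : S × S => surfDist S p.1 p.2 := by
  rw [continuous_iff_continuousAt]
  rintro ⟨⟨a, ha⟩, ⟨b, hb⟩⟩
  rw [Metric.continuousAt_iff]
  intro ε hε
  obtain ⟨r, hr, h1⟩ := hS.exists_surfDist_eq ha
  obtain ⟨r', hr', h2⟩ := hS.exists_surfDist_eq hb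
  refine ⟨min (min r r') (ε / 2), by positivity, ?_⟩
  rintro ⟨⟨x, hx⟩, ⟨y, hy⟩⟩ hxy
  rw [Prod.dist_eq, max_lt_iff, Subtype.dist_eq, Subtype.dist_eq, lt_min_iff, lt_min_iff,
    lt_min_iff, lt_min_iff] at hxy
  simp only [dist_eq_norm] at hxy
  have e1 := h1 x hx hxy.1.1.1
  have e2 := h2 y hy hxy.2.1.2
  rw [norm_sub_rev] at e1 e2
  have t1 := hS.surfDist_triangle ha hx hb
  have t2 := hS.surfDist_triangle hx hy hb
  have t3 := hS.surfDist_triangle hx ha hy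
  have t4 := hS.surfDist_triangle ha hb hy
  rw [surfDist_comm y b] at t2
  rw [surfDist_comm x a] at t3
  rw [Real.dist_eq, abs_lt]
  simp only
  constructor <;> linarith [hxy.1.2, hxy.2.2]

theorem tendsto_surfDist {ι : Type*} {l : Filter ι} {f g : ι → E} (hf : ∀ i, f i ∈ S)
    (hg : ∀ i, g i ∈ S) (ha : a ∈ S) (hb : b ∈ S) (hfa : Tendsto f l (𝓝 a))
    (hgb : Tendsto g l (𝓝 b)) :
    Tendsto (fun i => surfDist S (f i) (g i)) l (𝓝 (surfDist S a b)) := by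
  have h : Tendsto (fun p : S × S => surfDist S p.1 p.2) (𝓝 (⟨a, ha⟩, ⟨b, hb⟩))
      (𝓝 (surfDist S a b)) :=
    hS.continuous_surfDist.tendsto ((⟨a, ha⟩ : S), (⟨b, hb⟩ : S))
  have hf' : Tendsto (fun i => (⟨f i, hf i⟩ : S)) l (𝓝 ⟨a, ha⟩) := tendsto_subtype_rng.2 hfa
  have hg' : Tendsto (fun i => (⟨g i, hg i⟩ : S)) l (𝓝 ⟨b, hb⟩) := tendsto_subtype_rng.2 hgb
  exact Tendsto.comp (f := fun i => ((⟨f i, hf i⟩ : S), (⟨g i, hg i⟩ : S))) h (hf'.prodMk_nhds hg')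

theorem continuousOn_surfDist {X : Type*} [TopologicalSpace X] {f g : X → E} {s : Set X}
    (hf : ContinuousOn f s) (hg : ContinuousOn g s) (hfS : MapsTo f s S) (hgS : MapsTo g s S) :
    ContinuousOn (fun x => surfDist S (f x) (g x)) s := by
  rw [continuousOn_iff_continuous_domRestrict] at *
  exact hS.continuous_surfDist.comp
    (g := fun p : S × S => surfDist S p.1 p.2)
    (f := fun x : s => ((⟨f x, hfS x.2⟩ : S), (⟨g x, hgS x.2⟩ : S)))
    ((hf.subtype_mk _).prodMk (hg.subtype_mk _))

end IsConicSurface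

end IntrinsicDistance

section Geodesics

variable {E : Type*} [NormedAddCommGroup E] [InnerProductSpace ℝ E] {S : Set E} {a b x y z : E}
  {γ α β : ℝ → E}

/-- A shortest path in `S` parametrized on `[0,1]` proportionally to arc length. -/
structure IsGeodesic (S : Set E) (a b : E) (γ : ℝ → E) : Prop where
  zero : γ 0 = a
  one : γ 1 = b
  mem : ∀ t ∈ Icc (0 : ℝ) 1, γ t ∈ S
  dist : ∀ s ∈ Icc (0 : ℝ) 1, ∀ t ∈ Icc (0 : ℝ) 1,
    surfDist S (γ s) (γ t) = surfDist S a b * |s - t|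

/-- `z` lies between `a` and `b` for the intrinsic distance of `S`. -/
def IsBtw (S : Set E) (a z b : E) : Prop :=
  surfDist S a z + surfDist S z b = surfDist S a b

theorem IsPathIn.add_intrinsicDist_le (h : IsPathIn S a b γ) {u w : ℝ} (hu : 0 ≤ u) (huw : u ≤ w)
    (hw : w ≤ 1) : intrinsicDist S a (γ u) + intrinsicDist S (γ u) (γ w) +
      intrinsicDist S (γ w) b ≤ pathLength γ := by
  have sub : ∀ s t, 0 ≤ s → s ≤ t → t ≤ 1 →
      intrinsicDist S (γ s) (γ t) ≤ eVariationOn γ (Icc s t) := fun s t hs hst ht =>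
    intrinsicDist_le_eVariationOn hst (h.1.mono (Icc_subset_Icc hs ht))
      (h.2.2.2.mono_left (Icc_subset_Icc hs ht))
  have h1 := sub 0 u le_rfl hu (huw.trans hw)
  have h2 := sub u w hu huw hw
  have h3 := sub w 1 (hu.trans huw) hw le_rfl
  rw [h.2.1] at h1
  rw [h.2.2.1] at h3
  have e1 := eVariationOn.Icc_add_Icc γ (s := univ) hu huw (mem_univ _)
  have e2 := eVariationOn.Icc_add_Icc γ (s := univ) (hu.trans huw) hw (mem_univ _)
  simp only [univ_inter] at e1 e2
  rw [pathLength, ← e2, ← e1]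
  gcongr

namespace IsConicSurface

variable (hS : IsConicSurface S)
include hS

theorem isGeodesic_of_le (ha : γ 0 = a) (hb : γ 1 = b) (hm : ∀ t ∈ Icc (0 : ℝ) 1, γ t ∈ S)
    (h : ∀ s ∈ Icc (0 : ℝ) 1, ∀ t ∈ Icc (0 : ℝ) 1, s ≤ t →
      surfDist S (γ s) (γ t) ≤ surfDist S a b * (t - s)) : IsGeodesic S a b γ := by
  have h0 : (0 : ℝ) ∈ Icc (0 : ℝ) 1 := by simp
  have h1 : (1 : ℝ) ∈ Icc (0 : ℝ) 1 := by simp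
  have key : ∀ s ∈ Icc (0 : ℝ) 1, ∀ t ∈ Icc (0 : ℝ) 1, s ≤ t →
      surfDist S (γ s) (γ t) = surfDist S a b * (t - s) := by
    intro s hs t ht hst
    refine le_antisymm (h s hs t ht hst) ?_
    have e1 := h 0 h0 s hs hs.1
    have e2 := h t ht 1 h1 ht.2
    have t1 := hS.surfDist_triangle (hm 0 h0) (hm s hs) (hm 1 h1)
    have t2 := hS.surfDist_triangle (hm s hs) (hm t ht) (hm 1 h1)
    rw [ha, hb] at *
    linarith
  refine ⟨ha, hb, hm, fun s hs t ht => ?_⟩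
  rcases le_total s t with hst | hst
  · rw [key s hs t ht hst, abs_sub_comm, abs_of_nonneg (by linarith)]
  · rw [surfDist_comm, key t ht s hs hst, abs_of_nonneg (by linarith)]

theorem exists_almost_geodesic (ha : a ∈ S) (hb : b ∈ S) {ε : ℝ} (hε : 0 < ε) :
    ∃ f : ℝ → S, (f 0 : E) = a ∧ surfDist S (f 1) b ≤ ε ∧
      ∀ s ∈ Icc (0 : ℝ) 1, ∀ t ∈ Icc (0 : ℝ) 1,
        surfDist S (f s) (f t) ≤ surfDist S a b * |s - t| + ε := by
  obtain ⟨γ, hγ, hl⟩ : ∃ γ, IsPathIn S a b γ ∧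
      pathLength γ < ENNReal.ofReal (surfDist S a b + ε) := by
    have : intrinsicDist S a b < ENNReal.ofReal (surfDist S a b + ε) := by
      rw [← hS.ofReal_surfDist ha hb]
      exact (ENNReal.ofReal_lt_ofReal_iff (by linarith [surfDist_nonneg (S := S) a b])).2
        (by linarith)
    simpa [intrinsicDist, iInf_lt_iff] using this
  have key : ∀ u w, 0 ≤ u → u ≤ w → w ≤ 1 → surfDist S a (γ u) + surfDist S (γ u) (γ w) +
      surfDist S (γ w) b ≤ surfDist S a b + ε := by
    intro u w hu huw hw
    have hu' : γ u ∈ S := hγ.2.2.2 ⟨hu, huw.trans hw⟩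
    have hw' : γ w ∈ S := hγ.2.2.2 ⟨hu.trans huw, hw⟩
    have h1 := (IsPathIn.add_intrinsicDist_le hγ hu huw hw).trans hl.le
    rw [← hS.ofReal_surfDist ha hu', ← hS.ofReal_surfDist hu' hw', ← hS.ofReal_surfDist hw' hb,
      ← ENNReal.ofReal_add (surfDist_nonneg _ _) (surfDist_nonneg _ _),
      ← ENNReal.ofReal_add (add_nonneg (surfDist_nonneg _ _) (surfDist_nonneg _ _))
        (surfDist_nonneg _ _)] at h1
    exact (ENNReal.ofReal_le_ofReal_iff (by linarith [surfDist_nonneg (S := S) a b])).1 h1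
  have hτ : ∀ s ∈ Icc (0 : ℝ) 1, ∃ u ∈ Icc (0 : ℝ) 1,
      surfDist S a (γ u) = surfDist S a b * s := by
    intro s hs
    have hc : ContinuousOn (fun u => surfDist S a (γ u)) (Icc 0 1) :=
      hS.continuousOn_surfDist continuousOn_const hγ.1 (fun _ _ => ha) hγ.2.2.2
    have := intermediate_value_Icc zero_le_one hc
    simp only [hγ.2.1, hγ.2.2.1, hS.surfDist_self ha] at this
    have h0 := surfDist_nonneg (S := S) a b
    obtain ⟨u, hu, h⟩ := this ⟨mul_nonneg h0 hs.1, mul_le_of_le_one_right h0 hs.2⟩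
    exact ⟨u, hu, h⟩
  choose! τ hτ1 hτ2 using hτ
  have hmem : ∀ s ∈ Icc (0 : ℝ) 1, γ (τ s) ∈ S := fun s hs => hγ.2.2.2 (hτ1 s hs)
  have hord : ∀ s ∈ Icc (0 : ℝ) 1, ∀ t ∈ Icc (0 : ℝ) 1, τ s ≤ τ t →
      surfDist S (γ (τ s)) (γ (τ t)) ≤ surfDist S a b * |s - t| + ε := by
    intro s hs t ht hst
    have k := key _ _ (hτ1 s hs).1 hst (hτ1 t ht).2
    have t1 := hS.surfDist_triangle ha (hmem t ht) hb
    rw [hτ2 t ht] at t1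
    rw [hτ2 s hs] at k
    have := mul_le_mul_of_nonneg_left (neg_le_abs (s - t)) (surfDist_nonneg (S := S) a b)
    linarith
  classical
  refine ⟨fun s => if h : s ∈ Icc (0 : ℝ) 1 then ⟨γ (τ s), hmem s h⟩ else ⟨a, ha⟩, ?_, ?_, ?_⟩
  · have h0 : (0 : ℝ) ∈ Icc (0 : ℝ) 1 := by simp
    simp only [dif_pos h0]
    have := hτ2 0 h0
    rw [mul_zero] at this
    exact (hS.eq_of_surfDist_le_zero ha (hmem 0 h0) this.le).symm
  · have h1 : (1 : ℝ) ∈ Icc (0 : ℝ) 1 := by simp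
    simp only [dif_pos h1]
    have k := key _ _ (hτ1 1 h1).1 le_rfl (hτ1 1 h1).2
    rw [hτ2 1 h1, hS.surfDist_self (hmem 1 h1)] at k
    linarith
  · intro s hs t ht
    simp only [dif_pos hs, dif_pos ht]
    rcases le_total (τ s) (τ t) with h | h
    · exact hord s hs t ht h
    · rw [surfDist_comm, abs_sub_comm]; exact hord t ht s hs h

theorem exists_isGeodesic (ha : a ∈ S) (hb : b ∈ S) : ∃ γ, IsGeodesic S a b γ := by
  have : CompactSpace S := isCompact_iff_compactSpace.1 hS.isCompact
  let K : ℕ → Set (ℝ → S) := fun n =>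
    {f | (f 0 : E) = a} ∩ {f | surfDist S (f 1) b ≤ 1 / ((n : ℝ) + 1)} ∩
      ⋂ s ∈ Icc (0 : ℝ) 1, ⋂ t ∈ Icc (0 : ℝ) 1,
        {f | surfDist S (f s) (f t) ≤ surfDist S a b * |s - t| + 1 / ((n : ℝ) + 1)}
  have hcont : ∀ s t : ℝ, Continuous fun f : ℝ → S => surfDist S (f s) (f t) := fun s t =>
    hS.continuous_surfDist.comp (g := fun p : S × S => surfDist S p.1 p.2)
      (f := fun f : ℝ → S => (f s, f t)) ((continuous_apply s).prodMk (continuous_apply t))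
  have hcont' : ∀ s : ℝ, Continuous fun f : ℝ → S => surfDist S (f s) b := fun s =>
    hS.continuous_surfDist.comp (g := fun p : S × S => surfDist S p.1 p.2)
      (f := fun f : ℝ → S => (f s, (⟨b, hb⟩ : S))) ((continuous_apply s).prodMk continuous_const)
  have hclosed : ∀ n, IsClosed (K n) := by
    intro n
    refine (IsClosed.inter (isClosed_eq (continuous_subtype_val.comp (continuous_apply 0))
      continuous_const) (isClosed_le (hcont' 1) continuous_const)).inter ?_
    exact isClosed_biInter fun s _ => isClosed_biInter fun t _ =>
      isClosed_le (hcont s t) continuous_const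
  have hne : ∀ n, (K n).Nonempty := by
    intro n
    obtain ⟨f, h1, h2, h3⟩ := hS.exists_almost_geodesic ha hb (ε := 1 / ((n : ℝ) + 1))
      (by positivity)
    exact ⟨f, ⟨h1, h2⟩, mem_iInter₂.2 fun s hs => mem_iInter₂.2 fun t ht => h3 s hs t ht⟩
  have hanti : ∀ n, K (n + 1) ⊆ K n := by
    intro n f hf
    have hle : 1 / (((n + 1 : ℕ) : ℝ) + 1) ≤ 1 / ((n : ℝ) + 1) := by
      apply one_div_le_one_div_of_le (by positivity)
      push_cast; linarith
    refine ⟨⟨hf.1.1, le_trans hf.1.2 hle⟩, mem_iInter₂.2 fun s hs => mem_iInter₂.2 fun t ht => ?_⟩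
    have : surfDist S (f s) (f t) ≤ _ := mem_iInter₂.1 (mem_iInter₂.1 hf.2 s hs) t ht
    exact this.trans (by gcongr)
  obtain ⟨f, hf⟩ := IsCompact.nonempty_iInter_of_sequence_nonempty_isCompact_isClosed K hanti hne
    (hclosed 0).isCompact hclosed
  rw [mem_iInter] at hf
  have hlim : Tendsto (fun n : ℕ => 1 / ((n : ℝ) + 1)) atTop (𝓝 0) :=
    tendsto_one_div_add_atTop_nhds_zero_nat
  refine ⟨fun t => f t, hS.isGeodesic_of_le (hf 0).1.1 ?_ (fun t _ => (f t).2) ?_⟩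
  · exact hS.eq_of_surfDist_le_zero (f 1).2 hb (ge_of_tendsto' hlim fun n => (hf n).1.2)
  · intro s hs t ht hst
    have h2 := hlim.const_add (surfDist S a b * (t - s))
    rw [add_zero] at h2
    refine ge_of_tendsto' h2 fun n => ?_
    have : surfDist S (f s) (f t) ≤ _ := mem_iInter₂.1 (mem_iInter₂.1 (hf n).2 s hs) t ht
    rwa [abs_sub_comm, abs_of_nonneg (by linarith)] at this

end IsConicSurface

namespace IsGeodesic

variable (h : IsGeodesic S a b γ)
include h

theorem left_mem : a ∈ S := h.zero ▸ h.mem 0 (by simp)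

theorem right_mem : b ∈ S := h.one ▸ h.mem 1 (by simp)

theorem dist_left {t : ℝ} (ht : t ∈ Icc (0 : ℝ) 1) :
    surfDist S a (γ t) = surfDist S a b * t := by
  have := h.dist 0 (by simp) t ht
  rwa [h.zero, zero_sub, abs_neg, abs_of_nonneg ht.1] at this

theorem dist_right {t : ℝ} (ht : t ∈ Icc (0 : ℝ) 1) :
    surfDist S (γ t) b = surfDist S a b * (1 - t) := by
  have := h.dist t ht 1 (by simp)
  rwa [h.one, abs_sub_comm, abs_of_nonneg (by linarith [ht.2])] at this

theorem isBtw {t : ℝ} (ht : t ∈ Icc (0 : ℝ) 1) : IsBtw S a (γ t) b := by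
  rw [IsBtw, h.dist_left ht, h.dist_right ht]; ring

theorem norm_sub_le (hS : IsConicSurface S) {s t : ℝ} (hs : s ∈ Icc (0 : ℝ) 1)
    (ht : t ∈ Icc (0 : ℝ) 1) : ‖γ s - γ t‖ ≤ surfDist S a b * |s - t| :=
  (hS.norm_sub_le_surfDist (h.mem s hs) (h.mem t ht)).trans (h.dist s hs t ht).le

theorem continuousOn (hS : IsConicSurface S) : ContinuousOn γ (Icc 0 1) := by
  have : LipschitzOnWith (surfDist S a b).toNNReal γ (Icc 0 1) := by
    refine LipschitzOnWith.of_dist_le_mul fun s hs t ht => ?_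
    rw [dist_eq_norm, Real.dist_eq, Real.coe_toNNReal _ (surfDist_nonneg _ _)]
    exact h.norm_sub_le hS hs ht
  exact this.continuousOn

theorem isShortestPath (hS : IsConicSurface S) : IsShortestPath S a b γ := by
  have hp : IsPathIn S a b γ := ⟨h.continuousOn hS, h.zero, h.one, h.mem⟩
  refine ⟨hp, le_antisymm ?_ (iInf₂_le γ hp)⟩
  have := eVariationOn_le_of_lipschitz (γ := γ) (K := surfDist S a b) zero_le_one
    fun s hs t ht => h.norm_sub_le hS hs ht
  rw [← hS.ofReal_surfDist h.left_mem h.right_mem]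
  simpa [pathLength] using this

end IsGeodesic

namespace IsConicSurface

variable (hS : IsConicSurface S)
include hS

theorem isBtw_trans_right {c : E} (ha : a ∈ S) (hx : x ∈ S) (hy : y ∈ S) (hc : c ∈ S)
    (h1 : IsBtw S a x y) (h2 : IsBtw S a y c) : IsBtw S a x c ∧ IsBtw S x y c := by
  unfold IsBtw at *
  have t1 := hS.surfDist_triangle ha hx hc
  have t2 := hS.surfDist_triangle hx hy hc
  constructor <;> linarith

/-- Two geodesics whose concatenation is distance-realizing form a geodesic. -/
theorem exists_isGeodesic_through (ha : a ∈ S) (hz : z ∈ S) (hb : b ∈ S) (h : IsBtw S a z b) :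
    ∃ γ, IsGeodesic S a b γ ∧ ∃ s ∈ Icc (0 : ℝ) 1, γ s = z := by
  obtain ⟨α, hα⟩ := hS.exists_isGeodesic ha hz
  obtain ⟨β, hβ⟩ := hS.exists_isGeodesic hz hb
  have n1 := surfDist_nonneg (S := S) a z
  have n2 := surfDist_nonneg (S := S) z b
  have hsum : surfDist S a z + surfDist S z b = surfDist S a b := h
  rcases n1.eq_or_lt with h0 | h0
  · have : a = z := hS.eq_of_surfDist_le_zero ha hz h0.symm.le
    subst this
    exact ⟨β, hβ, 0, by simp, hβ.zero⟩
  rcases n2.eq_or_lt with h0' | h0'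
  · have : z = b := hS.eq_of_surfDist_le_zero hz hb h0'.symm.le
    subst this
    exact ⟨α, hα, 1, by simp, hα.one⟩
  set p := surfDist S a z
  set q := surfDist S z b
  have hL : surfDist S a b = p + q := hsum.symm
  set γ : ℝ → E := fun t => if t * (p + q) ≤ p then α (t * (p + q) / p)
    else β ((t * (p + q) - p) / q) with hγ
  have m1 : ∀ t, 0 ≤ t → t * (p + q) ≤ p → t * (p + q) / p ∈ Icc (0 : ℝ) 1 := fun t ht h =>
    ⟨by positivity, (div_le_one h0).2 h⟩
  have m2 : ∀ t, t ≤ 1 → p ≤ t * (p + q) → (t * (p + q) - p) / q ∈ Icc (0 : ℝ) 1 :=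
    fun t ht h => ⟨div_nonneg (by linarith) h0'.le, (div_le_one h0').2 (by nlinarith)⟩
  refine ⟨γ, hS.isGeodesic_of_le ?_ ?_ ?_ ?_, p / (p + q), ⟨by positivity, ?_⟩, ?_⟩
  · simp [hγ, h0.le, hα.zero]
  · have : ¬ (1 * (p + q) ≤ p) := by linarith
    simp only [hγ, if_neg this]
    rw [← hβ.one]; congr 1; field_simp; ring
  · intro t ht
    simp only [hγ]
    split_ifs with h
    · exact hα.mem _ (m1 t ht.1 h)
    · exact hβ.mem _ (m2 t ht.2 (le_of_not_ge h))
  · intro s hs t ht hst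
    rw [hL]
    simp only [hγ]
    split_ifs with h1 h2 h2
    · rw [hα.dist _ (m1 s hs.1 h1) _ (m1 t ht.1 h2), ← sub_div, abs_div, abs_of_pos h0,
        abs_sub_comm, abs_of_nonneg (by nlinarith), mul_div_cancel₀ _ h0.ne']
      linarith
    · have t1 := hS.surfDist_triangle (hα.mem _ (m1 s hs.1 h1)) hz
        (hβ.mem _ (m2 t ht.2 (le_of_not_ge h2)))
      rw [hα.dist_right (m1 s hs.1 h1), hβ.dist_left (m2 t ht.2 (le_of_not_ge h2))] at t1
      refine t1.trans (le_of_eq ?_)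
      change p * _ + q * _ = _
      field_simp
      ring
    · exact absurd ((mul_le_mul_of_nonneg_right hst (by positivity)).trans h2) h1
    · rw [hβ.dist _ (m2 s hs.2 (le_of_not_ge h1)) _ (m2 t ht.2 (le_of_not_ge h2)), ← sub_div,
        abs_div, abs_of_pos h0', abs_sub_comm, abs_of_nonneg (by nlinarith),
        mul_div_cancel₀ _ h0'.ne']
      linarith
  · exact (div_le_one (by positivity)).2 (by linarith)
  · have e : p / (p + q) * (p + q) = p := by field_simp
    simp only [hγ, e, le_refl, if_true, div_self h0.ne', hα.one]

end IsConicSurface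

end Geodesics

section CutPoints

variable {E : Type*} [NormedAddCommGroup E] [InnerProductSpace ℝ E] {S P : Set E} {v a b x y z : E}
  {γ α β : ℝ → E}

theorem IsGeodesic.eq_const_of_surfDist_eq_zero (hS : IsConicSurface S) (h : IsGeodesic S a b γ)
    (h0 : surfDist S a b = 0) {t : ℝ} (ht : t ∈ Icc (0 : ℝ) 1) : γ t = a := by
  refine (hS.eq_of_surfDist_le_zero h.left_mem (h.mem t ht) ?_).symm
  rw [h.dist_left ht, h0, zero_mul]

/-- A point between the endpoints of `γ` at the right distance lies on some geodesic, at the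
prescribed time. -/
theorem IsConicSurface.exists_isGeodesic_eq (hS : IsConicSurface S) (ha : a ∈ S) (hz : z ∈ S)
    (hb : b ∈ S) (h : IsBtw S a z b) {t : ℝ} (ht : surfDist S a z = surfDist S a b * t)
    (ht' : t ∈ Icc (0 : ℝ) 1) : ∃ α, IsGeodesic S a b α ∧ α t = z := by
  obtain ⟨α, hα, s, hs, rfl⟩ := hS.exists_isGeodesic_through ha hz hb h
  refine ⟨α, hα, ?_⟩
  rw [hα.dist_left hs] at ht
  rcases mul_eq_mul_left_iff.1 ht with h | h
  · rw [h]
  · rw [hα.eq_const_of_surfDist_eq_zero hS h hs, hα.eq_const_of_surfDist_eq_zero hS h ht']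

theorem isCutPoint_of_ne (hS : IsConicSurface (frontier P)) (hα : IsGeodesic (frontier P) v x α)
    (hβ : IsGeodesic (frontier P) v x β) {t : ℝ} (ht : t ∈ Icc (0 : ℝ) 1) (hne : α t ≠ β t) :
    IsCutPoint P v x := by
  refine ⟨α, β, hα.isShortestPath hS, hβ.isShortestPath hS, fun h => ?_⟩
  have : α t ∈ β '' Icc 0 1 := h ▸ mem_image_of_mem α ht
  obtain ⟨s, hs, hst⟩ := this
  have e := hα.dist_left ht
  rw [← hst, hβ.dist_left hs] at e
  rcases mul_eq_mul_left_iff.1 e with h | h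
  · exact hne (by rw [← hst, h])
  · exact hne (by rw [hα.eq_const_of_surfDist_eq_zero hS h ht,
      hβ.eq_const_of_surfDist_eq_zero hS h ht])

theorem IsCutPoint.mem_frontier (h : IsCutPoint P v x) : x ∈ frontier P := by
  obtain ⟨γ, -, h, -⟩ := h
  exact h.1.2.2.1 ▸ h.1.2.2.2 (right_mem_Icc.2 zero_le_one)

theorem IsShortestPath.isBtw (hS : IsConicSurface S) (h : IsShortestPath S a b γ) {t : ℝ}
    (ht : t ∈ Icc (0 : ℝ) 1) : IsBtw S a (γ t) b := by
  have ha : a ∈ S := h.1.2.1 ▸ h.1.2.2.2 (left_mem_Icc.2 zero_le_one)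
  have hb : b ∈ S := h.1.2.2.1 ▸ h.1.2.2.2 (right_mem_Icc.2 zero_le_one)
  have hm : γ t ∈ S := h.1.2.2.2 ht
  refine le_antisymm ?_ (hS.surfDist_triangle ha hm hb)
  have := IsPathIn.add_intrinsicDist_le h.1 ht.1 le_rfl ht.2
  rw [h.2, ← hS.ofReal_surfDist ha hm, ← hS.ofReal_surfDist hm hm, ← hS.ofReal_surfDist hm hb,
    hS.surfDist_self hm, ENNReal.ofReal_zero, add_zero, ← hS.ofReal_surfDist ha hb,
    ← ENNReal.ofReal_add (surfDist_nonneg _ _) (surfDist_nonneg _ _)] at this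
  exact (ENNReal.ofReal_le_ofReal_iff (surfDist_nonneg _ _)).1 this

theorem exists_ne_of_isCutPoint (hS : IsConicSurface (frontier P)) (h : IsCutPoint P v x) :
    ∃ α β, IsGeodesic (frontier P) v x α ∧ IsGeodesic (frontier P) v x β ∧
      ∃ t ∈ Icc (0 : ℝ) 1, α t ≠ β t := by
  have hx := IsCutPoint.mem_frontier h
  obtain ⟨γ₁, γ₂, h1, h2, hne⟩ := h
  wlog hsub : ¬ γ₁ '' Icc 0 1 ⊆ γ₂ '' Icc 0 1 generalizing γ₁ γ₂
  · exact this γ₂ γ₁ h2 h1 hne.symm fun hs => hne ((not_not.1 hsub).antisymm hs)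
  obtain ⟨_, ⟨s, hs, rfl⟩, hz⟩ := not_subset.1 hsub
  have hv : v ∈ frontier P := h1.1.2.1 ▸ h1.1.2.2.2 (left_mem_Icc.2 zero_le_one)
  have hzS := h1.1.2.2.2 hs
  have hb1 : surfDist _ _ _ + _ = _ := IsShortestPath.isBtw hS h1 hs
  have hc : ContinuousOn (fun u => surfDist (frontier P) v (γ₂ u)) (Icc 0 1) :=
    hS.continuousOn_surfDist continuousOn_const h2.1.1 (fun _ _ => hv) h2.1.2.2.2
  have hivt := intermediate_value_Icc zero_le_one hc
  simp only [h2.1.2.1, h2.1.2.2.1, hS.surfDist_self hv] at hivt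
  obtain ⟨u, hu, hu'⟩ := hivt ⟨surfDist_nonneg v (γ₁ s), by
    linarith [surfDist_nonneg (S := frontier P) (γ₁ s) x]⟩
  simp only at hu'
  have hb2 := IsShortestPath.isBtw hS h2 hu
  obtain ⟨α, hα, t, ht, hαt⟩ := hS.exists_isGeodesic_through hv hzS hx hb1
  obtain ⟨β, hβ, hβt⟩ := hS.exists_isGeodesic_eq hv (h2.1.2.2.2 hu) hx hb2
    (by rw [hu', ← hαt, hα.dist_left ht]) ht
  exact ⟨α, β, hα, hβ, t, ht, fun h => hz ⟨u, hu, by rw [← hβt, ← h, hαt]⟩⟩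

theorem IsConicSurface.isBtw_of_tendsto (hS : IsConicSurface S) {ι : Type*} {l : Filter ι}
    [l.NeBot] {f g : ι → E} (hv : v ∈ S) (hf : ∀ i, f i ∈ S) (hg : ∀ i, g i ∈ S) (ha : a ∈ S)
    (hb : b ∈ S) (hfa : Tendsto f l (𝓝 a)) (hgb : Tendsto g l (𝓝 b))
    (h : ∀ i, IsBtw S v (f i) (g i)) : IsBtw S v a b := by
  have h1 := (hS.tendsto_surfDist (fun _ => hv) hf hv ha tendsto_const_nhds hfa).add
    (hS.tendsto_surfDist hf hg ha hb hfa hgb)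
  have h2 := hS.tendsto_surfDist (fun _ => hv) hg hv hb tendsto_const_nhds hgb
  exact tendsto_nhds_unique (h1.congr h) h2

/-- Geodesics to points near the endpoint of a unique geodesic stay near it. -/
theorem IsConicSurface.exists_forall_norm_sub_lt (hS : IsConicSurface S) (hγ : IsGeodesic S v z γ)
    (huniq : ∀ α, IsGeodesic S v z α → ∀ t ∈ Icc (0 : ℝ) 1, α t = γ t) {ε : ℝ} (hε : 0 < ε) :
    ∃ δ > 0, ∀ x ∈ S, ‖x - z‖ < δ → ∀ α, IsGeodesic S v x α → ∀ t ∈ Icc (0 : ℝ) 1,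
      ‖α t - γ t‖ < ε := by
  by_contra! hcon
  have hpos : ∀ n : ℕ, (0 : ℝ) < 1 / ((n : ℝ) + 1) := fun n => by positivity
  choose x hxS hxz α hα t ht hfar using fun n : ℕ => hcon _ (hpos n)
  have hv := hγ.left_mem
  have hz := hγ.right_mem
  obtain ⟨⟨p, t₀⟩, ⟨hpS, ht₀⟩, k, hk, hlim⟩ := (hS.isCompact.prod
    (isCompact_Icc (a := (0 : ℝ)) (b := 1))).tendsto_subseq
    (x := fun n => (α n (t n), t n)) fun n => ⟨(hα n).mem _ (ht n), ht n⟩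
  rw [Prod.tendsto_iff] at hlim
  simp only at hpS ht₀
  obtain ⟨hl1, hl2⟩ := hlim
  simp only [Function.comp_def] at hl1 hl2
  have hxlim : Tendsto x atTop (𝓝 z) := by
    rw [tendsto_iff_norm_sub_tendsto_zero]
    exact squeeze_zero (fun _ => norm_nonneg _) (fun n => (hxz n).le)
      tendsto_one_div_add_atTop_nhds_zero_nat
  have hxk := hxlim.comp hk.tendsto_atTop
  have hbtw : IsBtw S v p z := hS.isBtw_of_tendsto hv (fun n => (hα (k n)).mem _ (ht (k n)))
    (fun n => hxS (k n)) hpS hz hl1 hxk fun n => (hα (k n)).isBtw (ht (k n))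
  have hd : surfDist S v p = surfDist S v z * t₀ := by
    have h1 := hS.tendsto_surfDist (fun _ => hv) (fun n => (hα (k n)).mem _ (ht (k n))) hv hpS
      tendsto_const_nhds hl1
    have h2 := (hS.tendsto_surfDist (fun _ => hv) (fun n => hxS (k n)) hv hz
      tendsto_const_nhds hxk).mul hl2
    exact tendsto_nhds_unique h1 (h2.congr fun n => ((hα (k n)).dist_left (ht (k n))).symm)
  obtain ⟨β, hβ, hβp⟩ := hS.exists_isGeodesic_eq hv hpS hz hbtw hd ht₀
  have hp : p = γ t₀ := by rw [← hβp, huniq β hβ t₀ ht₀]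
  have hγl : Tendsto (fun n => γ (t (k n))) atTop (𝓝 (γ t₀)) :=
    ((hγ.continuousOn hS) t₀ ht₀).tendsto.comp
      (tendsto_nhdsWithin_iff.2 ⟨hl2, Eventually.of_forall fun n => ht (k n)⟩)
  have := ge_of_tendsto' (hl1.sub hγl).norm fun n => hfar (k n)
  rw [hp, sub_self, norm_zero] at this
  linarith

/-- Near `z` the surface is intrinsically isometric, through `φ`, to a flat disc. -/
structure IsFlatChart (S : Set E) (z : E) (r : ℝ) (φ : E → E) : Prop where
  pos : 0 < r
  dist : ∀ x ∈ S, ‖x - z‖ < r → ∀ y ∈ S, ‖y - z‖ < r → surfDist S x y = ‖φ x - φ y‖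
  extend : ∀ x ∈ S, ‖x - z‖ < r → ∀ c : ℝ, ‖c • (φ x - φ z)‖ < r →
    ∃ y ∈ S, ‖y - z‖ < r ∧ φ y = φ z + c • (φ x - φ z)

def IsFlatAt (S : Set E) (z : E) : Prop := ∃ r φ, IsFlatChart S z r φ

/-- Two points lie in a common flat chart. -/
def InCommonChart (S : Set E) (x y : E) : Prop :=
  ∃ z r φ, IsFlatChart S z r φ ∧ ‖x - z‖ < r ∧ ‖y - z‖ < r

theorem exists_inCommonChart (hγ : ContinuousOn γ (Icc 0 1))
    (hflat : ∀ t ∈ Icc (0 : ℝ) 1, IsFlatAt S (γ t)) :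
    ∃ r > 0, ∀ t ∈ Icc (0 : ℝ) 1, ∀ x y, ‖x - γ t‖ < r → ‖y - γ t‖ < r → InCommonChart S x y := by
  choose! r φ hφ using hflat
  have hK : IsCompact (γ '' Icc 0 1) := isCompact_Icc.image_of_continuousOn hγ
  obtain ⟨δ, hδ, h⟩ := lebesgue_number_lemma_of_metric (ι := Icc (0 : ℝ) 1)
    (c := fun t => ball (γ t) (r t)) hK (fun _ => isOpen_ball) (by
      rintro _ ⟨t, ht, rfl⟩
      exact mem_iUnion.2 ⟨⟨t, ht⟩, mem_ball_self (hφ t ht).pos⟩)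
  refine ⟨δ, hδ, fun t ht x y hx hy => ?_⟩
  obtain ⟨s, hs⟩ := h _ (mem_image_of_mem γ ht)
  refine ⟨_, _, _, hφ s s.2, ?_, ?_⟩
  · have := hs (show x ∈ ball (γ t) δ by rwa [mem_ball, dist_eq_norm])
    rwa [mem_ball, dist_eq_norm] at this
  · have := hs (show y ∈ ball (γ t) δ by rwa [mem_ball, dist_eq_norm])
    rwa [mem_ball, dist_eq_norm] at this

/-- `α` has locally constant speed and is locally distance-realizing on `(0,1)`. -/
def IsLocalGeodesic (S : Set E) (α : ℝ → E) : Prop :=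
  ∀ t ∈ Ioo (0 : ℝ) 1, ∃ L, ∃ η > 0, ∀ s s', |s - t| < η → |s' - t| < η →
    surfDist S (α s) (α s') = L * |s - s'|

theorem IsGeodesic.isLocalGeodesic (h : IsGeodesic S a b γ) : IsLocalGeodesic S γ := by
  intro t ht
  refine ⟨surfDist S a b, min t (1 - t), lt_min ht.1 (by linarith [ht.2]), fun s s' hs hs' => ?_⟩
  rw [lt_min_iff, abs_lt, abs_lt] at hs hs'
  exact h.dist s ⟨by linarith [hs.1.1], by linarith [hs.2.2]⟩ s'
    ⟨by linarith [hs'.1.1], by linarith [hs'.2.2]⟩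

theorem IsFlatChart.eq_lineMap {r : ℝ} {φ : E → E} (h : IsFlatChart S z r φ) {p q m : E}
    (hp : p ∈ S) (hq : q ∈ S) (hm : m ∈ S) (hpr : ‖p - z‖ < r) (hqr : ‖q - z‖ < r)
    (hmr : ‖m - z‖ < r) {c : ℝ} (h1 : surfDist S p m = c * surfDist S p q)
    (h2 : surfDist S m q = (1 - c) * surfDist S p q) : φ m = AffineMap.lineMap (φ p) (φ q) c := by
  rw [h.dist p hp hpr m hm hmr, h.dist p hp hpr q hq hqr] at h1
  rw [h.dist m hm hmr q hq hqr, h.dist p hp hpr q hq hqr] at h2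
  exact eq_lineMap_of_dist_eq_mul_of_dist_eq_mul (by rw [dist_eq_norm, dist_eq_norm, h1])
    (by rw [dist_eq_norm, dist_eq_norm, h2])

theorem eqOn_of_isLocalGeodesic (hS : IsConicSurface S) (hα : ContinuousOn α (Icc 0 1))
    (hβ : ContinuousOn β (Icc 0 1)) (hαS : MapsTo α (Icc 0 1) S) (hβS : MapsTo β (Icc 0 1) S)
    (hα' : IsLocalGeodesic S α) (hβ' : IsLocalGeodesic S β) (h0 : α 0 = β 0) (h1 : α 1 = β 1)
    (hch : ∀ t ∈ Ioo (0 : ℝ) 1, InCommonChart S (α t) (β t)) : EqOn α β (Icc 0 1) := by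
  set f : ℝ → ℝ := fun t => surfDist S (α t) (β t) with hf
  have hfc : ContinuousOn f (Icc 0 1) := hS.continuousOn_surfDist hα hβ hαS hβS
  obtain ⟨t₁, ht₁, hmax⟩ := isCompact_Icc.exists_isMaxOn (nonempty_Icc.2 zero_le_one) hfc
  by_cases hM : f t₁ ≤ 0
  · intro t ht
    exact hS.eq_of_surfDist_le_zero (hαS ht) (hβS ht) ((hmax ht).trans hM)
  exfalso
  push Not at hM
  have hcomp : IsCompact (Icc (0 : ℝ) 1 ∩ f ⁻¹' {f t₁}) :=
    isCompact_Icc.of_isClosed_subset (hfc.preimage_isClosed_of_isClosed isClosed_Icc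
      isClosed_singleton) inter_subset_left
  obtain ⟨t, ⟨ht, hft⟩, hleast⟩ := hcomp.exists_isLeast ⟨t₁, ht₁, rfl⟩
  rw [mem_preimage, mem_singleton_iff] at hft
  have hf0 : f 0 = 0 := by
    simp only [hf, h0]; exact hS.surfDist_self (hβS (left_mem_Icc.2 zero_le_one))
  have hf1 : f 1 = 0 := by
    simp only [hf, h1]; exact hS.surfDist_self (hβS (right_mem_Icc.2 zero_le_one))
  have ht' : t ∈ Ioo (0 : ℝ) 1 := by
    refine ⟨lt_of_le_of_ne ht.1 ?_, lt_of_le_of_ne ht.2 ?_⟩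
    · rintro rfl; linarith
    · rintro rfl; linarith
  obtain ⟨z, r, φ, hφ, hαz, hβz⟩ := hch t ht'
  obtain ⟨L, η, hη, hL⟩ := hα' t ht'
  obtain ⟨L', η', hη', hL'⟩ := hβ' t ht'
  have hnear : ∀ {γ : ℝ → E}, ContinuousOn γ (Icc 0 1) → ‖γ t - z‖ < r →
      ∀ᶠ s in 𝓝 t, ‖γ s - z‖ < r := by
    intro γ hγ h
    have hc : ContinuousAt γ t := hγ.continuousAt (Icc_mem_nhds ht'.1 ht'.2)
    exact (hc.sub continuousAt_const).norm.eventually_lt continuousAt_const h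
  obtain ⟨ε, hε, hb⟩ := Metric.eventually_nhds_iff.1
    (((hnear hα hαz).and (hnear hβ hβz)).and (Ioo_mem_nhds ht'.1 ht'.2))
  obtain ⟨k, hk, hk'⟩ := exists_between (show 0 < min ε (min η η') by positivity)
  rw [lt_min_iff, lt_min_iff] at hk'
  have hm : ∀ c : ℝ, |c| ≤ 1 → dist (t + c * k) t < ε := fun c hc => by
    rw [Real.dist_eq, add_sub_cancel_left, abs_mul, abs_of_pos hk]
    nlinarith
  have hm' : ∀ c : ℝ, |c| ≤ 1 → |t + c * k - t| < min η η' := fun c hc => by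
    rw [add_sub_cancel_left, abs_mul, abs_of_pos hk, lt_min_iff]
    constructor <;> nlinarith
  have a1 : |(-1 : ℝ)| ≤ 1 := by simp
  have a2 : |(1 : ℝ)| ≤ 1 := by simp
  have a0 : |(0 : ℝ)| ≤ 1 := by simp
  have hmid : ∀ {γ : ℝ → E} {L η₁ : ℝ}, min η η' ≤ η₁ → MapsTo γ (Icc 0 1) S →
      (∀ c : ℝ, |c| ≤ 1 → ‖γ (t + c * k) - z‖ < r) →
      (∀ s s', |s - t| < η₁ → |s' - t| < η₁ → surfDist S (γ s) (γ s') = L * |s - s'|) →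
      φ (γ t) = AffineMap.lineMap (φ (γ (t + (-1) * k))) (φ (γ (t + 1 * k))) (1 / 2 : ℝ) := by
    intro γ L η₁ hη₁ hγS hγr hγL
    have i1 := Ioo_subset_Icc_self (hb (hm _ a1)).2
    have i2 := Ioo_subset_Icc_self (hb (hm _ a2)).2
    have r0 := hγr 0 a0
    have b1 := (hm' _ a1).trans_le hη₁
    have b2 := (hm' _ a2).trans_le hη₁
    have b0 := (hm' _ a0).trans_le hη₁
    rw [zero_mul, add_zero] at r0 b0
    refine hφ.eq_lineMap (hγS i1) (hγS i2) (hγS ht) (hγr _ a1) (hγr _ a2) r0 ?_ ?_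
    · rw [hγL _ _ b1 b0, hγL _ _ b1 b2, show t + -1 * k - t = -k by ring,
        show t + -1 * k - (t + 1 * k) = -(2 * k) by ring, abs_neg, abs_neg, abs_of_pos hk,
        abs_of_pos (by linarith)]
      ring
    · rw [hγL _ _ b0 b2, hγL _ _ b1 b2, show t - (t + 1 * k) = -k by ring,
        show t + -1 * k - (t + 1 * k) = -(2 * k) by ring, abs_neg, abs_neg, abs_of_pos hk,
        abs_of_pos (by linarith)]
      ring
  have e1 := hmid (min_le_left _ _) hαS (fun c hc => (hb (hm c hc)).1.1) hL
  have e2 := hmid (min_le_right _ _) hβS (fun c hc => (hb (hm c hc)).1.2) hL'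
  have hd : ∀ c : ℝ, |c| ≤ 1 → f (t + c * k) = ‖φ (α (t + c * k)) - φ (β (t + c * k))‖ :=
    fun c hc => hφ.dist _ (hαS (Ioo_subset_Icc_self (hb (hm c hc)).2)) (hb (hm c hc)).1.1 _
      (hβS (Ioo_subset_Icc_self (hb (hm c hc)).2)) (hb (hm c hc)).1.2
  have d0 := hd 0 a0
  rw [zero_mul, add_zero] at d0
  have d1 := hd _ a1
  have d2 := hd _ a2
  have hle2 : f (t + 1 * k) ≤ f t₁ := hmax (Ioo_subset_Icc_self (hb (hm _ a2)).2)
  have hlt1 : f (t + (-1) * k) < f t₁ := by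
    refine lt_of_le_of_ne (hmax (Ioo_subset_Icc_self (hb (hm _ a1)).2)) fun h => ?_
    have := hleast ⟨Ioo_subset_Icc_self (hb (hm _ a1)).2, h⟩
    linarith
  have : φ (α t) - φ (β t) = (1 / 2 : ℝ) • ((φ (α (t + (-1) * k)) - φ (β (t + (-1) * k))) +
      (φ (α (t + 1 * k)) - φ (β (t + 1 * k)))) := by
    rw [e1, e2, AffineMap.lineMap_apply_module, AffineMap.lineMap_apply_module]
    module
  rw [this, norm_smul, Real.norm_of_nonneg (by norm_num)] at d0
  have := norm_add_le (φ (α (t + (-1) * k)) - φ (β (t + (-1) * k)))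
      (φ (α (t + 1 * k)) - φ (β (t + 1 * k)))
  linarith

theorem notMem_closure_cutPoints (hS : IsConicSurface (frontier P))
    (hγ : IsGeodesic (frontier P) v x γ)
    (hflat : ∀ t ∈ Icc (0 : ℝ) 1, IsFlatAt (frontier P) (γ t)) (hx : ¬ IsCutPoint P v x) :
    x ∉ closure {y | IsCutPoint P v y} := by
  intro hcl
  obtain ⟨r, hr, hch⟩ := exists_inCommonChart (hγ.continuousOn hS) hflat
  obtain ⟨δ, hδ, hst⟩ := hS.exists_forall_norm_sub_lt hγ (fun α hα t ht => by
    by_contra hne; exact hx (isCutPoint_of_ne hS hα hγ ht hne)) hr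
  obtain ⟨y, hy, hxy⟩ := Metric.mem_closure_iff.1 hcl δ hδ
  rw [dist_comm, dist_eq_norm] at hxy
  obtain ⟨α, β, hα, hβ, t, ht, hne⟩ := exists_ne_of_isCutPoint hS hy
  refine hne (eqOn_of_isLocalGeodesic hS (hα.continuousOn hS) (hβ.continuousOn hS) hα.mem hβ.mem
    hα.isLocalGeodesic hβ.isLocalGeodesic (by rw [hα.zero, hβ.zero]) (by rw [hα.one, hβ.one])
    (fun s hs => ?_) ht)
  have hs' := Ioo_subset_Icc_self hs
  exact hch s hs' _ _ (hst y hα.right_mem hxy α hα s hs') (hst y hα.right_mem hxy β hβ s hs')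

/-- A geodesic ending at a flat point which is not a cut point extends as a geodesic. -/
theorem exists_isBtw_extension (hS : IsConicSurface (frontier P))
    (hγ : IsGeodesic (frontier P) v z γ)
    (hflat : ∀ t ∈ Icc (0 : ℝ) 1, IsFlatAt (frontier P) (γ t)) (hz : ¬ IsCutPoint P v z)
    (hvz : v ≠ z) {ε : ℝ} (hε : 0 < ε) :
    ∃ y ∈ frontier P, y ≠ z ∧ ‖y - z‖ < ε ∧ IsBtw (frontier P) v z y := by
  set S := frontier P with hSdef
  obtain ⟨r₀, hr₀, hch⟩ := exists_inCommonChart (hγ.continuousOn hS) hflat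
  obtain ⟨δ, hδ, hst⟩ := hS.exists_forall_norm_sub_lt hγ (fun α hα t ht => by
    by_contra hne; exact hz (isCutPoint_of_ne hS hα hγ ht hne)) hr₀
  obtain ⟨r, φ, hφ⟩ := hflat 1 (by simp)
  rw [hγ.one] at hφ
  have hzS := hγ.right_mem
  have hvS := hγ.left_mem
  set L := surfDist S v z with hL
  have hL0 : 0 < L := lt_of_not_ge fun h => hvz (hS.eq_of_surfDist_le_zero hvS hzS h)
  have hzz : ‖z - z‖ < r := by simpa using hφ.pos
  -- a point shortly before the end
  obtain ⟨κ, hκ, hκ'⟩ := exists_between (show 0 < min 1 (min (r / L) (min (r₀ / L)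
    (min (δ / L) (ε / L)))) from by have := hφ.pos; positivity)
  simp only [lt_min_iff, lt_div_iff₀ hL0] at hκ'
  obtain ⟨hκ1, hκr, hκr₀, hκδ, hκε⟩ := hκ'
  have hs₀ : 1 - κ ∈ Icc (0 : ℝ) 1 := ⟨by linarith, by linarith⟩
  set w := γ (1 - κ) with hw
  have hwS : w ∈ S := hγ.mem _ hs₀
  have hnear : ∀ s ∈ Icc (1 - κ) 1, ‖γ s - z‖ < r := by
    intro s hs
    have := hγ.norm_sub_le hS (s := s) (t := 1) ⟨by linarith [hs.1], hs.2⟩ (by simp)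
    rw [hγ.one, abs_sub_comm, abs_of_nonneg (by linarith [hs.2])] at this
    nlinarith [hs.1]
  have hwr : ‖w - z‖ < r := hnear _ ⟨le_rfl, by linarith⟩
  have hwz : ‖φ w - φ z‖ = L * κ := by
    rw [← hφ.dist w hwS hwr z hzS hzz, hγ.dist_right hs₀]; ring
  have hex : ∀ u ∈ Icc (0 : ℝ) κ, ∃ y ∈ S, ‖y - z‖ < r ∧
      φ y = φ z + (-(u / κ)) • (φ w - φ z) := by
    intro u hu
    refine hφ.extend w hwS hwr _ ?_
    rw [norm_smul, hwz, norm_neg, Real.norm_of_nonneg (div_nonneg hu.1 hκ.le)]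
    have : u / κ * (L * κ) = u * L := by field_simp
    rw [this]
    nlinarith [hu.2]
  choose! Y hYS hYr hYφ using hex
  set e : ℝ → E := fun s => if s ≤ 1 then γ s else Y (s - 1) with he
  have he1 : ∀ s ≤ 1, e s = γ s := fun s hs => by simp [he, hs]
  have he2 : ∀ s, 1 < s → e s = Y (s - 1) := fun s hs => by simp [he, not_le.2 hs]
  have heS : ∀ s ∈ Icc (0 : ℝ) (1 + κ), e s ∈ S := by
    intro s hs
    rcases le_or_gt s 1 with h | h
    · rw [he1 s h]; exact hγ.mem s ⟨hs.1, h⟩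
    · rw [he2 s h]; exact hYS _ ⟨by linarith, by linarith [hs.2]⟩
  have hφe : ∀ s ∈ Icc (1 - κ) (1 + κ), ‖e s - z‖ < r ∧
      φ (e s) = φ z + ((1 - s) / κ) • (φ w - φ z) := by
    intro s hs
    rcases le_or_gt s 1 with h | h
    · rw [he1 s h]
      have hs' : s ∈ Icc (0 : ℝ) 1 := ⟨by linarith [hs.1], h⟩
      refine ⟨hnear s ⟨hs.1, h⟩, ?_⟩
      have hlm := hφ.eq_lineMap hzS hwS (hγ.mem s hs') hzz hwr (hnear s ⟨hs.1, h⟩)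
        (c := (1 - s) / κ) ?_ ?_
      · rw [hlm, AffineMap.lineMap_apply_module]; module
      · rw [surfDist_comm, hγ.dist_right hs', surfDist_comm z w, hγ.dist_right hs₀]
        field_simp; ring
      · rw [hγ.dist s hs' _ hs₀, surfDist_comm z w, hγ.dist_right hs₀,
          abs_of_nonneg (by linarith [hs.1])]
        field_simp; ring
    · rw [he2 s h]
      have hs' : s - 1 ∈ Icc (0 : ℝ) κ := ⟨by linarith, by linarith [hs.2]⟩
      refine ⟨hYr _ hs', ?_⟩
      rw [hYφ _ hs']; congr 2; ring
  have hdist : ∀ s ∈ Icc (1 - κ) (1 + κ), ∀ t ∈ Icc (1 - κ) (1 + κ),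
      surfDist S (e s) (e t) = L * |s - t| := by
    intro s hs t ht
    have p1 := hφe s hs
    have p2 := hφe t ht
    rw [hφ.dist _ (heS s ⟨by linarith [hs.1], hs.2⟩) p1.1 _ (heS t ⟨by linarith [ht.1], ht.2⟩) p2.1,
      p1.2, p2.2, add_sub_add_left_eq_sub, ← sub_smul, norm_smul, hwz, Real.norm_eq_abs,
      abs_sub_comm s t, ← sub_div, abs_div, abs_of_pos hκ, sub_sub_sub_cancel_left]
    field_simp
  have hdist' : ∀ s ∈ Icc (0 : ℝ) (1 + κ), ∀ t ∈ Icc (0 : ℝ) (1 + κ), s ≤ t →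
      surfDist S (e s) (e t) ≤ L * (t - s) := by
    intro s hs t ht hst
    rcases le_or_gt t 1 with h | h
    · rw [he1 t h, he1 s (hst.trans h), hγ.dist s ⟨hs.1, hst.trans h⟩ t ⟨ht.1, h⟩, abs_sub_comm,
        abs_of_nonneg (by linarith)]
    rcases le_or_gt (1 - κ) s with h' | h'
    · rw [hdist s ⟨h', hs.2⟩ t ⟨by linarith, ht.2⟩, abs_sub_comm, abs_of_nonneg (by linarith)]
    have t1 := hS.surfDist_triangle (heS s hs) (heS 1 ⟨by linarith, by linarith⟩) (heS t ht)
    rw [hdist 1 ⟨by linarith, by linarith⟩ t ⟨by linarith, ht.2⟩, he1 1 le_rfl, he1 s (by linarith),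
      hγ.dist s ⟨hs.1, by linarith⟩ 1 (by simp), abs_sub_comm, abs_of_nonneg (by linarith),
      abs_sub_comm, abs_of_nonneg (by linarith)] at t1
    rw [he1 s (by linarith)]
    linarith
  set y := e (1 + κ) with hy
  have hyS : y ∈ S := heS _ ⟨by linarith, le_rfl⟩
  have hzy : surfDist S z y = L * κ := by
    have := hdist 1 ⟨by linarith, by linarith⟩ (1 + κ) ⟨by linarith, le_rfl⟩
    rw [he1 1 le_rfl, hγ.one, abs_sub_comm, add_sub_cancel_left, abs_of_pos hκ] at this
    exact this
  have hyz : ‖y - z‖ ≤ L * κ := by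
    rw [norm_sub_rev, ← hzy]; exact hS.norm_sub_le_surfDist hzS hyS
  obtain ⟨β, hβ⟩ := hS.exists_isGeodesic hvS hyS
  have hpar : ∀ t ∈ Icc (0 : ℝ) 1, t * (1 + κ) ∈ Icc (0 : ℝ) (1 + κ) := fun t ht =>
    ⟨mul_nonneg ht.1 (by linarith), by nlinarith [ht.2]⟩
  have hLip : LipschitzOnWith (L * (1 + κ)).toNNReal (fun t => e (t * (1 + κ))) (Icc 0 1) := by
    refine LipschitzOnWith.of_dist_le_mul fun s hs t ht => ?_
    wlog hst : s ≤ t generalizing s t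
    · rw [dist_comm, dist_comm s]; exact this t ht s hs (le_of_not_ge hst)
    rw [dist_eq_norm, Real.dist_eq, Real.coe_toNNReal _ (by positivity), abs_sub_comm,
      abs_of_nonneg (by linarith)]
    refine (hS.norm_sub_le_surfDist (heS _ (hpar s hs)) (heS _ (hpar t ht))).trans ?_
    refine (hdist' _ (hpar s hs) _ (hpar t ht) (by nlinarith)).trans (le_of_eq ?_)
    ring
  have heq := eqOn_of_isLocalGeodesic hS hLip.continuousOn (hβ.continuousOn hS)
    (fun t ht => heS _ (hpar t ht)) hβ.mem ?_ hβ.isLocalGeodesic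
    (by simp only [zero_mul]; rw [he1 0 zero_le_one, hγ.zero, hβ.zero])
    (by simp only [one_mul]; rw [hβ.one]) ?_
  · have h1κ : 1 / (1 + κ) ∈ Icc (0 : ℝ) 1 :=
      ⟨by positivity, (div_le_one (by linarith)).2 (by linarith)⟩
    have h := heq h1κ
    simp only [one_div_mul_cancel (show (1 + κ) ≠ 0 by linarith)] at h
    rw [he1 1 le_rfl, hγ.one] at h
    refine ⟨y, hyS, ?_, by linarith, ?_⟩
    · intro hyz
      rw [hyz, hS.surfDist_self hzS] at hzy
      have : 0 < L * κ := by positivity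
      linarith
    · have := hβ.isBtw h1κ
      rwa [← h] at this
  · intro t ht
    have hp := hpar t (Ioo_subset_Icc_self ht)
    have hp0 : 0 < t * (1 + κ) := mul_pos ht.1 (by linarith)
    have hp1 : t * (1 + κ) < 1 + κ := by nlinarith [ht.2]
    rcases lt_or_ge (t * (1 + κ)) 1 with h | h
    · refine ⟨L * (1 + κ), min t (1 / (1 + κ) - t), lt_min ht.1 (by
        rw [sub_pos, lt_div_iff₀ (by linarith)]; exact h), fun s s' hs hs' => ?_⟩
      rw [lt_min_iff, abs_lt, abs_lt] at hs hs'
      have k1 : s * (1 + κ) ≤ 1 := by rw [← le_div_iff₀ (by linarith)]; linarith [hs.2.2]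
      have k2 : s' * (1 + κ) ≤ 1 := by rw [← le_div_iff₀ (by linarith)]; linarith [hs'.2.2]
      simp only
      rw [he1 _ k1, he1 _ k2, hγ.dist _ ⟨mul_nonneg (by linarith [hs.1.1]) (by linarith), k1⟩ _
        ⟨mul_nonneg (by linarith [hs'.1.1]) (by linarith), k2⟩, ← sub_mul, abs_mul,
        abs_of_pos (show 0 < 1 + κ by linarith)]
      ring
    · refine ⟨L * (1 + κ), min (κ / 2) (1 - t), lt_min (by linarith) (by linarith [ht.2]),
        fun s s' hs hs' => ?_⟩
      rw [lt_min_iff, abs_lt, abs_lt] at hs hs'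
      have q1 : ∀ s, -(κ / 2) < s - t → s - t < 1 - t → s * (1 + κ) ∈ Icc (1 - κ) (1 + κ) :=
        fun s h1 h2 => ⟨by nlinarith, by nlinarith⟩
      simp only
      rw [hdist _ (q1 s hs.1.1 hs.2.2) _ (q1 s' hs'.1.1 hs'.2.2), ← sub_mul, abs_mul,
        abs_of_pos (show 0 < 1 + κ by linarith)]
      ring
  · intro t ht
    have ht' := Ioo_subset_Icc_self ht
    refine hch t ht' _ _ ?_ (hst y hyS (by linarith) β hβ t ht')
    have hle : t ≤ t * (1 + κ) := by nlinarith [ht.1]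
    have h1 := hdist' t ⟨ht'.1, by linarith [ht'.2]⟩ _ (hpar t ht') hle
    have h2 := hS.norm_sub_le_surfDist (heS t ⟨ht'.1, by linarith [ht'.2]⟩) (heS _ (hpar t ht'))
    rw [he1 t ht'.2] at h1 h2
    rw [norm_sub_rev]
    have : L * (t * (1 + κ) - t) ≤ κ * L := by
      have : t * κ ≤ κ := by nlinarith [ht.2]
      nlinarith
    linarith

end CutPoints

section HalfSpaces

variable {E : Type*} [NormedAddCommGroup E] [InnerProductSpace ℝ E] {P : Set E} {ι : Type*}
  {n : ι → E} {c : ι → ℝ} {x y z q : E}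

theorem exists_forall_inner_lt [Finite ι] (n : ι → E) (c : ι → ℝ) (z : E) :
    ∃ r > 0, ∀ x, ‖x - z‖ < r → ∀ i, ⟪n i, z⟫ < c i → ⟪n i, x⟫ < c i := by
  have h : ∀ᶠ x in 𝓝 z, ∀ i, ⟪n i, z⟫ < c i → ⟪n i, x⟫ < c i := by
    rw [eventually_all]
    intro i
    by_cases hi : ⟪n i, z⟫ < c i
    · have hc : ContinuousAt (fun x => ⟪n i, x⟫) z := by fun_prop
      filter_upwards [hc.eventually_lt continuousAt_const hi] with x hx _ using hx
    · exact Eventually.of_forall fun x h => absurd h hi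
  obtain ⟨r, hr, h⟩ := Metric.eventually_nhds_iff.1 h
  exact ⟨r, hr, fun x hx => h (by rwa [dist_eq_norm])⟩

/-- Near `z`, every active constraint is active at `z`. -/
theorem exists_forall_active [Finite ι] (n : ι → E) (c : ι → ℝ) (z : E) (hz : ∀ i, ⟪n i, z⟫ ≤ c i) :
    ∃ r > 0, ∀ x, ‖x - z‖ < r → ∀ i, ⟪n i, x⟫ = c i → ⟪n i, z⟫ = c i := by
  obtain ⟨r, hr, h⟩ := exists_forall_inner_lt n c z
  refine ⟨r, hr, fun x hx i hi => ?_⟩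
  by_contra hne
  exact (h x hx i (lt_of_le_of_ne (hz i) hne)).ne hi

/-- `P` is the bounded intersection of the half-spaces `⟪n i, y⟫ ≤ c i`, with unit normals, and has
nonempty interior. -/
structure IsHPolytope (P : Set E) (n : ι → E) (c : ι → ℝ) : Prop where
  mem_iff : ∀ y, y ∈ P ↔ ∀ i, ⟪n i, y⟫ ≤ c i
  norm_eq_one : ∀ i, ‖n i‖ = 1
  isCompact : IsCompact P
  exists_lt : ∃ q, ∀ i, ⟪n i, q⟫ < c i

theorem finite_extremePoints_halfSpaces [Finite ι] (n : ι → E) (c : ι → ℝ) :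
    ({y | ∀ i, ⟪n i, y⟫ ≤ c i}.extremePoints ℝ).Finite := by
  refine Finite.of_injOn (f := fun y => {i | ⟪n i, y⟫ = c i}) (t := univ) (fun _ _ => mem_univ _)
    ?_ finite_univ
  intro y hy y' hy' heq
  by_contra hne
  have hpos : 0 < ‖y - y'‖ := norm_pos_iff.2 (sub_ne_zero.2 hne)
  obtain ⟨r, hr, h⟩ := exists_forall_inner_lt n c y
  have hyQ := hy.1
  have hmem : ∀ s : ℝ, |s| = r / (2 * ‖y - y'‖) → y + s • (y - y') ∈ {y | ∀ i, ⟪n i, y⟫ ≤ c i} := by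
    intro s hs i
    rcases (hyQ i).lt_or_eq with hi | hi
    · refine (h _ ?_ i hi).le
      rw [add_sub_cancel_left, norm_smul, Real.norm_eq_abs, hs]
      have : r / (2 * ‖y - y'‖) * ‖y - y'‖ = r / 2 := by field_simp
      linarith
    · have hi' : ⟪n i, y'⟫ = c i := by
        have : i ∈ {i | ⟪n i, y⟫ = c i} := hi
        simp only at heq
        rw [heq] at this
        exact this
      rw [inner_add_right, inner_smul_right, inner_sub_right, hi, hi']
      simp
  set s := r / (2 * ‖y - y'‖) with hs
  have hs0 : 0 < s := by positivity
  have e := hy.2 (hmem s (abs_of_pos hs0)) (hmem (-s) (by rw [abs_neg, abs_of_pos hs0]))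
    ⟨1 / 2, 1 / 2, by norm_num, by norm_num, by norm_num, by module⟩
  have : s • (y - y') = 0 := by simpa using e
  rcases smul_eq_zero.1 this with h | h
  · exact hs0.ne' h
  · exact hne (sub_eq_zero.1 h)

theorem convex_halfSpace_inner_le (g : E) (u : ℝ) : Convex ℝ {x | ⟪g, x⟫ ≤ u} := by
  simpa using convex_halfSpace_le (f := fun x => ⟪g, x⟫) (innerₛₗ ℝ g).isLinear u

theorem exists_isHPolytope [FiniteDimensional ℝ E] {A : Finset E}
    (hP : P = convexHull ℝ (A : Set E)) (hint : (interior P).Nonempty) :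
    ∃ (ι : Type) (_ : Finite ι) (n : ι → E) (c : ι → ℝ), IsHPolytope P n c := by
  obtain ⟨q, hq⟩ := hint
  have hcomp : IsCompact P := hP ▸ A.finite_toSet.isCompact_convexHull ℝ
  have hconv : Convex ℝ P := hP ▸ convex_convexHull ℝ _
  set Q : Set E := {y | ∀ a : A, ⟪(a : E) - q, y⟫ ≤ 1} with hQ
  have hQP : ∀ y ∈ Q, ∀ x ∈ P, ⟪y, x - q⟫ ≤ 1 := by
    intro y hy x hx
    have hsub : P ⊆ {x | ⟪y, x⟫ ≤ 1 + ⟪y, q⟫} := by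
      rw [hP]
      refine convexHull_min (fun a ha => ?_) (convex_halfSpace_inner_le y _)
      have := hy ⟨a, ha⟩
      rw [real_inner_comm, inner_sub_right] at this
      simp only [mem_ofPred_eq]; linarith
    have := hsub hx
    simp only [mem_ofPred_eq] at this
    rw [inner_sub_right]; linarith
  have hQclosed : IsClosed Q := by
    simp only [hQ, ofPred_forall]
    exact isClosed_iInter fun a => isClosed_le (by fun_prop) continuous_const
  have hQconv : Convex ℝ Q := by
    simp only [hQ, ofPred_forall]
    exact convex_iInter fun a => convex_halfSpace_inner_le _ _
  obtain ⟨ε, hε, hball⟩ := Metric.isOpen_iff.1 isOpen_interior q hq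
  have hQb : Q ⊆ closedBall 0 (2 / ε) := by
    intro y hy
    rw [mem_closedBall_zero_iff]
    by_cases h0 : y = 0
    · rw [h0, norm_zero]; positivity
    have hy0 : 0 < ‖y‖ := norm_pos_iff.2 h0
    have hm : q + (ε / (2 * ‖y‖)) • y ∈ P := by
      refine interior_subset (hball ?_)
      rw [mem_ball, dist_eq_norm, add_sub_cancel_left, norm_smul,
        Real.norm_of_nonneg (by positivity)]
      have : ε / (2 * ‖y‖) * ‖y‖ = ε / 2 := by field_simp
      linarith
    have := hQP y hy _ hm
    rw [add_sub_cancel_left, inner_smul_right, real_inner_self_eq_norm_sq] at this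
    rw [le_div_iff₀ hε]
    have e : ε / (2 * ‖y‖) * ‖y‖ ^ 2 = ‖y‖ * ε / 2 := by field_simp
    linarith
  have hQcomp : IsCompact Q := (isCompact_closedBall 0 _).of_isClosed_subset hQclosed hQb
  have hfin : (Q.extremePoints ℝ).Finite := finite_extremePoints_halfSpaces _ _
  have hmem : ∀ x, x ∈ P ↔ ∀ e ∈ Q.extremePoints ℝ, ⟪e, x - q⟫ ≤ 1 := by
    refine fun x => ⟨fun hx e he => hQP e he.1 x hx, fun hx => ?_⟩
    by_contra hxP
    obtain ⟨f, u, hf, hu⟩ := geometric_hahn_banach_closed_point hconv hcomp.isClosed hxP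
    set g := (InnerProductSpace.toDual ℝ E).symm f with hg
    have hfg : ∀ y, f y = ⟪g, y⟫ := fun y => by simp [hg]
    have hw : 0 < u - f q := by have := hf q (interior_subset hq); linarith
    have hyQ : (1 / (u - f q)) • g ∈ Q := by
      intro a
      rw [real_inner_comm, real_inner_smul_left, inner_sub_right, ← hfg, ← hfg, one_div,
        inv_mul_le_iff₀ hw]
      have := hf a (hP ▸ subset_convexHull ℝ _ a.2)
      linarith
    have hsub : Q ⊆ {y | ⟪x - q, y⟫ ≤ 1} := by
      rw [← closure_convexHull_extremePoints hQcomp hQconv]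
      refine closure_minimal (convexHull_min (fun e he => ?_) (convex_halfSpace_inner_le _ _))
        (isClosed_le (by fun_prop) continuous_const)
      rw [mem_ofPred_eq, real_inner_comm]; exact hx e he
    have := hsub hyQ
    rw [mem_ofPred_eq, real_inner_comm, real_inner_smul_left, inner_sub_right, ← hfg, ← hfg,
        one_div,
      inv_mul_le_iff₀ hw] at this
    linarith
  have hfin' : Finite {e : E // e ∈ Q.extremePoints ℝ ∧ e ≠ 0} :=
    (hfin.subset fun e he => he.1 : {e | e ∈ Q.extremePoints ℝ ∧ e ≠ 0}.Finite).to_subtype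
  obtain ⟨k, ⟨φ⟩⟩ := Finite.exists_equiv_fin {e : E // e ∈ Q.extremePoints ℝ ∧ e ≠ 0}
  have hpos : ∀ i : Fin k, 0 < ‖(φ.symm i : E)‖ := fun i => norm_pos_iff.2 (φ.symm i).2.2
  refine ⟨Fin k, inferInstance, fun i => (‖(φ.symm i : E)‖⁻¹) • (φ.symm i : E),
    fun i => ‖(φ.symm i : E)‖⁻¹ * (1 + ⟪(φ.symm i : E), q⟫), ?_, ?_, hcomp, q, ?_⟩
  · intro y
    rw [hmem]
    constructor
    · intro h i
      have := h _ (φ.symm i).2.1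
      rw [inner_sub_right] at this
      rw [real_inner_smul_left]
      exact mul_le_mul_of_nonneg_left (by linarith) (inv_nonneg.2 (hpos i).le)
    · intro h e he
      by_cases h0 : e = 0
      · simp [h0]
      have := h (φ ⟨e, he, h0⟩)
      have hp := hpos (φ ⟨e, he, h0⟩)
      rw [real_inner_smul_left, mul_le_mul_iff_right₀ (inv_pos.2 hp)] at this
      simp only [Equiv.symm_apply_apply] at this
      rw [inner_sub_right]; linarith
  · intro i
    rw [norm_smul, norm_inv, norm_norm, inv_mul_cancel₀ (hpos i).ne']
  · intro i
    rw [real_inner_smul_left]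
    exact mul_lt_mul_of_pos_left (by linarith) (inv_pos.2 (hpos i))

namespace IsHPolytope

variable (hP : IsHPolytope P n c)
include hP

theorem eq_setOf : P = {y | ∀ i, ⟪n i, y⟫ ≤ c i} := Set.ext hP.mem_iff

theorem convex : Convex ℝ P := by
  rw [hP.eq_setOf, ofPred_forall]
  exact convex_iInter fun i => convex_halfSpace_inner_le _ _

theorem mem_interior_iff [Finite ι] : y ∈ interior P ↔ ∀ i, ⟪n i, y⟫ < c i := by
  constructor
  · intro h i
    obtain ⟨ε, hε, hball⟩ := Metric.isOpen_iff.1 isOpen_interior y h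
    have hm : y + (ε / 2) • n i ∈ P := by
      refine interior_subset (hball ?_)
      rw [mem_ball, dist_eq_norm, add_sub_cancel_left, norm_smul, hP.norm_eq_one,
        Real.norm_of_nonneg (by positivity)]
      linarith
    have := (hP.mem_iff _).1 hm i
    rw [inner_add_right, inner_smul_right, real_inner_self_eq_norm_sq, hP.norm_eq_one] at this
    linarith
  · intro h
    obtain ⟨r, hr, hlt⟩ := exists_forall_inner_lt n c y
    rw [mem_interior_iff_mem_nhds]
    refine Metric.mem_nhds_iff.2 ⟨r, hr, fun x hx => (hP.mem_iff x).2 fun i => ?_⟩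
    rw [mem_ball, dist_eq_norm] at hx
    exact (hlt x hx i (h i)).le

theorem mem_frontier_iff [Finite ι] : y ∈ frontier P ↔ y ∈ P ∧ ∃ i, ⟪n i, y⟫ = c i := by
  rw [hP.isCompact.isClosed.frontier_eq, Set.mem_sdiff, hP.mem_interior_iff]
  push Not
  refine and_congr_right fun hy => exists_congr fun i => ?_
  exact ⟨fun h => ((hP.mem_iff y).1 hy i).antisymm h, fun h => h.ge⟩

theorem frontier_subset : frontier P ⊆ P := hP.isCompact.isClosed.frontier_subset

theorem inner_le (hy : y ∈ frontier P) (i : ι) : ⟪n i, y⟫ ≤ c i :=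
  (hP.mem_iff y).1 (hP.frontier_subset hy) i

theorem segment_subset_frontier [Finite ι] (hx : x ∈ P) (hy : y ∈ P) {i : ι} (hxi : ⟪n i, x⟫ = c i)
    (hyi : ⟪n i, y⟫ = c i) : segment ℝ x y ⊆ frontier P := by
  intro w hw
  refine hP.mem_frontier_iff.2 ⟨hP.convex.segment_subset hx hy hw, i, ?_⟩
  obtain ⟨a, b, -, -, hab, rfl⟩ := hw
  rw [inner_add_right, inner_smul_right, inner_smul_right, hxi, hyi, ← add_mul, hab, one_mul]

theorem isConicSurface [Finite ι] (hrank : 1 < Module.rank ℝ E) : IsConicSurface (frontier P) where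
  isCompact := hP.isCompact.of_isClosed_subset isClosed_frontier hP.frontier_subset
  isPreconnected := by
    obtain ⟨q, hq⟩ := hP.exists_lt
    obtain ⟨h, -, -, h3⟩ := exists_homeomorph_image_interior_closure_frontier_eq_unitBall hP.convex
      ⟨q, hP.mem_interior_iff.2 hq⟩ hP.isCompact.isBounded
    rw [← h.isPreconnected_image, h3]
    exact isPreconnected_sphere hrank 0 1
  exists_segment_subset := by
    intro z hz
    obtain ⟨r, hr, h⟩ := exists_forall_active n c z (hP.inner_le hz)
    refine ⟨r, hr, fun x hx hxz => ?_⟩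
    obtain ⟨hxP, i, hi⟩ := hP.mem_frontier_iff.1 hx
    exact hP.segment_subset_frontier (hP.frontier_subset hz) hxP (h x hxz i hi) hi

end IsHPolytope

end HalfSpaces

section Faces

variable {E : Type*} [NormedAddCommGroup E] [InnerProductSpace ℝ E] {P F : Set E} {ι : Type*}
  {n : ι → E} {c : ι → ℝ} {v x y z q u : E}

/-- The span of the normals of the constraints active at `z`. -/
def activeSpan (n : ι → E) (c : ι → ℝ) (z : E) : Submodule ℝ E :=
  Submodule.span ℝ (n '' {i | ⟪n i, z⟫ = c i})

def IsWarped (n : ι → E) (c : ι → ℝ) (z : E) : Prop :=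
  3 ≤ Module.finrank ℝ (activeSpan n c z)

theorem mem_activeSpan {i : ι} (hi : ⟪n i, z⟫ = c i) : n i ∈ activeSpan n c z :=
  Submodule.subset_span ⟨i, hi, rfl⟩

theorem activeSpan_mono (h : ∀ i, ⟪n i, x⟫ = c i → ⟪n i, y⟫ = c i) :
    activeSpan n c x ≤ activeSpan n c y :=
  Submodule.span_mono (image_mono h)

theorem activeSpan_eq_bot (h : ∀ i, ⟪n i, x⟫ ≠ c i) : activeSpan n c x = ⊥ := by
  rw [activeSpan, Submodule.span_eq_bot]
  rintro _ ⟨i, hi, rfl⟩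
  exact absurd hi (h i)

theorem mem_orthogonal_activeSpan_iff :
    u ∈ (activeSpan n c z)ᗮ ↔ ∀ i, ⟪n i, z⟫ = c i → ⟪n i, u⟫ = 0 := by
  rw [Submodule.mem_orthogonal]
  refine ⟨fun h i hi => h _ (mem_activeSpan hi), fun h w hw => ?_⟩
  induction hw using Submodule.span_induction with
  | mem x hx => obtain ⟨i, hi, rfl⟩ := hx; exact h i hi
  | zero => simp
  | add x y _ _ hx hy => rw [inner_add_left, hx, hy, add_zero]
  | smul a x _ hx => rw [real_inner_smul_left, hx, mul_zero]

namespace IsHPolytope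

variable (hP : IsHPolytope P n c)
include hP

theorem exists_forall_add_smul_mem [Finite ι] (hz : z ∈ P)
    (hu : ∀ i, ⟪n i, z⟫ = c i → ⟪n i, u⟫ ≤ 0) :
    ∃ t > 0, ∀ s : ℝ, 0 ≤ s → s ≤ t → z + s • u ∈ P := by
  obtain ⟨r, hr, h⟩ := exists_forall_inner_lt n c z
  refine ⟨r / (‖u‖ + 1), by positivity, fun s hs hst => (hP.mem_iff _).2 fun i => ?_⟩
  rcases ((hP.mem_iff z).1 hz i).lt_or_eq with hi | hi
  · refine (h _ ?_ i hi).le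
    rw [add_sub_cancel_left, norm_smul, Real.norm_of_nonneg hs]
    rw [le_div_iff₀ (by positivity)] at hst
    rcases hs.eq_or_lt with h0 | h0
    · rw [← h0]; simpa using hr
    · nlinarith
  · rw [inner_add_right, inner_smul_right, hi]
    nlinarith [hu i hi]

theorem orthogonal_activeSpan_le [Finite ι] (hF : IsFace P F) (hz : z ∈ F) :
    (activeSpan n c z)ᗮ ≤ (affineSpan ℝ F).direction := by
  intro u hu
  rw [mem_orthogonal_activeSpan_iff] at hu
  have hzP := hF.2.2.1 hz
  obtain ⟨t, ht, h1⟩ := hP.exists_forall_add_smul_mem hzP fun i hi => (hu i hi).le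
  obtain ⟨t', ht', h2⟩ := hP.exists_forall_add_smul_mem (u := -u) hzP fun i hi => by
    rw [inner_neg_right, hu i hi, neg_zero]
  set s := min t t' with hs
  have hs0 : 0 < s := lt_min ht ht'
  have hm : z + s • u ∈ F := hF.2.2.2 (h1 s hs0.le (min_le_left _ _))
      (h2 s hs0.le (min_le_right _ _))
    hz ⟨1 / 2, 1 / 2, by norm_num, by norm_num, by norm_num, by module⟩
  have := AffineSubspace.vsub_mem_direction (subset_affineSpan ℝ F hm) (subset_affineSpan ℝ F hz)
  rw [vsub_eq_sub, add_sub_cancel_left] at this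
  exact (Submodule.smul_mem_iff _ hs0.ne').1 this

theorem isFace_active (hz : z ∈ P) : IsFace P {y ∈ P | ∀ i, ⟪n i, z⟫ = c i → ⟪n i, y⟫ = c i} := by
  refine ⟨⟨z, hz, fun _ h => h⟩, ?_, fun y hy => hy.1, ?_⟩
  · intro x hx y hy a b ha hb hab
    refine ⟨hP.convex hx.1 hy.1 ha hb hab, fun i hi => ?_⟩
    rw [inner_add_right, inner_smul_right, inner_smul_right, hx.2 i hi, hy.2 i hi, ← add_mul, hab,
      one_mul]
  · intro x hx y hy w hw hseg
    refine ⟨hx, fun i hi => ?_⟩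
    obtain ⟨a, b, ha, hb, hab, rfl⟩ := hseg
    have h := hw.2 i hi
    rw [inner_add_right, inner_smul_right, inner_smul_right] at h
    have h1 := (hP.mem_iff x).1 hx i
    have h2 := (hP.mem_iff y).1 hy i
    refine h1.antisymm ?_
    by_contra! hlt
    have e : a * c i + b * c i = c i := by rw [← add_mul, hab, one_mul]
    nlinarith

theorem exists_face_iff_isWarped [Finite ι] [FiniteDimensional ℝ E] {d : ℕ}
    (hd : Module.finrank ℝ E = d + 1) :
    (∃ F, IsFace P F ∧ faceDim F + 2 ≤ d ∧ z ∈ F) ↔ z ∈ frontier P ∧ IsWarped n c z := by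
  have hfr := Submodule.finrank_add_finrank_orthogonal (activeSpan n c z)
  constructor
  · rintro ⟨F, hF, hdim, hz⟩
    have h := Submodule.finrank_mono (hP.orthogonal_activeSpan_le hF hz)
    have hw : IsWarped n c z := by
      unfold IsWarped
      unfold faceDim at hdim
      lia
    refine ⟨hP.mem_frontier_iff.2 ⟨hF.2.2.1 hz, ?_⟩, hw⟩
    by_contra! hne
    rw [IsWarped, activeSpan_eq_bot hne, finrank_bot] at hw
    lia
  · rintro ⟨hz, hw⟩
    have hzP := hP.frontier_subset hz
    refine ⟨_, hP.isFace_active hzP, ?_, hzP, fun _ h => h⟩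
    have hle : affineSpan ℝ {y ∈ P | ∀ i, ⟪n i, z⟫ = c i → ⟪n i, y⟫ = c i} ≤
        AffineSubspace.mk' z (activeSpan n c z)ᗮ := by
      rw [affineSpan_le]
      intro y hy
      rw [SetLike.mem_coe, AffineSubspace.mem_mk', vsub_eq_sub, mem_orthogonal_activeSpan_iff]
      intro i hi
      rw [inner_sub_right, hy.2 i hi, hi, sub_self]
    have h := Submodule.finrank_mono (AffineSubspace.direction_le hle)
    rw [AffineSubspace.direction_mk'] at h
    unfold IsWarped at hw
    unfold faceDim
    lia

theorem mem_frontier_of_intrinsicInterior [Finite ι] [FiniteDimensional ℝ E] {d : ℕ}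
    (hd : Module.finrank ℝ E = d + 1) (hF : IsFace P F) (hdim : faceDim F = d)
    (hv : v ∈ intrinsicInterior ℝ F) : v ∈ frontier P ∧ ¬ IsWarped n c v := by
  have hvF := intrinsicInterior_subset hv
  have hvP := hF.2.2.1 hvF
  unfold faceDim at hdim
  constructor
  · refine hP.mem_frontier_iff.2 ⟨hvP, ?_⟩
    by_contra! hne
    have h := Submodule.finrank_mono (hP.orthogonal_activeSpan_le hF hvF)
    rw [activeSpan_eq_bot hne, Submodule.bot_orthogonal_eq_top, finrank_top] at h
    lia
  · have hle : (affineSpan ℝ F).direction ≤ (activeSpan n c v)ᗮ := by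
      intro u hu
      rw [mem_orthogonal_activeSpan_iff]
      intro i hi
      obtain ⟨w, hw, hwv⟩ := hv
      have hmem : ∀ s : ℝ, v + s • u ∈ affineSpan ℝ F := fun s => by
        have := AffineSubspace.vadd_mem_of_mem_direction ((affineSpan ℝ F).direction.smul_mem s hu)
          (subset_affineSpan ℝ F hvF)
        rwa [vadd_eq_add, add_comm] at this
      have hcont : Continuous fun s : ℝ => (⟨v + s • u, hmem s⟩ : affineSpan ℝ F) := by
        refine Continuous.subtype_mk ?_ _
        fun_prop
      have h0 : (⟨v + (0 : ℝ) • u, hmem 0⟩ : affineSpan ℝ F) = w := Subtype.ext (by simp [hwv])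
      have hev : ∀ᶠ s : ℝ in 𝓝 0, v + s • u ∈ F := by
        have hn := mem_interior_iff_mem_nhds.1 hw
        rw [← h0] at hn
        exact hcont.continuousAt.eventually_mem hn
      obtain ⟨ε, hε, h⟩ := Metric.eventually_nhds_iff.1 hev
      have key : ∀ s : ℝ, |s| < ε → s * ⟪n i, u⟫ ≤ 0 := fun s hs => by
        have := (hP.mem_iff _).1 (hF.2.2.1 (h (y := s) (by rwa [Real.dist_eq, sub_zero]))) i
        rw [inner_add_right, inner_smul_right, hi] at this
        linarith
      have k1 := key (ε / 2) (by rw [abs_of_pos (by positivity)]; linarith)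
      have k2 := key (-(ε / 2)) (by rw [abs_neg, abs_of_pos (by positivity)]; linarith)
      nlinarith
    have h := Submodule.finrank_mono hle
    have hfr := Submodule.finrank_add_finrank_orthogonal (activeSpan n c v)
    unfold IsWarped
    lia

end IsHPolytope

theorem exists_forall_not_isWarped [Finite ι] [FiniteDimensional ℝ E] (hz : ∀ i, ⟪n i, z⟫ ≤ c i)
    (hw : ¬ IsWarped n c z) : ∃ r > 0, ∀ x, ‖x - z‖ < r → ¬ IsWarped n c x := by
  obtain ⟨r, hr, h⟩ := exists_forall_active n c z hz
  refine ⟨r, hr, fun x hx hwx => hw (hwx.trans (Submodule.finrank_mono (activeSpan_mono (h x hx))))⟩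

end Faces

section Shortcuts

variable {E : Type*} [NormedAddCommGroup E] [InnerProductSpace ℝ E] {P : Set E} {ι : Type*}
  {n : ι → E} {c : ι → ℝ} {v w x y z a b p q u : E}

theorem norm_sub_le_of_forall_inner_le_zero {a' b' : E} (ha : ⟪a - a', b' - a'⟫ ≤ 0)
    (hb : ⟪b - b', a' - b'⟫ ≤ 0) : ‖a' - b'‖ ≤ ‖a - b‖ := by
  have h : ‖a' - b'‖ ^ 2 ≤ ⟪a - b, a' - b'⟫ := by
    have e : ‖a' - b'‖ ^ 2 - ⟪a - b, a' - b'⟫ = ⟪a - a', b' - a'⟫ + ⟪b - b', a' - b'⟫ := by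
      rw [← real_inner_self_eq_norm_sq]
      simp only [inner_sub_left, inner_sub_right]
      ring
    linarith
  have h2 := real_inner_le_norm (a - b) (a' - b')
  rcases (norm_nonneg (a' - b')).eq_or_lt with h0 | h0
  · rw [← h0]; positivity
  · nlinarith

namespace IsHPolytope

variable (hP : IsHPolytope P n c)
include hP

theorem exists_projection [Finite ι] : ∃ π : E → E, (∀ a b, ‖π a - π b‖ ≤ ‖a - b‖) ∧
    (∀ a ∈ P, π a = a) ∧ ∀ a, a ∉ interior P → π a ∈ frontier P := by
  have hne : P.Nonempty := by
    obtain ⟨q, hq⟩ := hP.exists_lt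
    exact ⟨q, (hP.mem_iff q).2 fun i => (hq i).le⟩
  have h : ∀ a : E, ∃ a' ∈ P, ∀ w ∈ P, ⟪a - a', w - a'⟫ ≤ 0 := fun a => by
    obtain ⟨a', ha', h⟩ := exists_norm_eq_iInf_of_complete_convex hne hP.isCompact.isComplete
      hP.convex a
    exact ⟨a', ha', (norm_eq_iInf_iff_real_inner_le_zero hP.convex ha').1 h⟩
  choose π hπ hin using h
  have hid : ∀ a ∈ P, π a = a := fun a ha => by
    have := hin a a ha
    rw [real_inner_self_eq_norm_sq] at this
    have h0 : ‖a - π a‖ = 0 := by nlinarith [norm_nonneg (a - π a)]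
    exact (sub_eq_zero.1 (norm_eq_zero.1 h0)).symm
  refine ⟨π, fun a b => norm_sub_le_of_forall_inner_le_zero (hin a _ (hπ b)) (hin b _ (hπ a)), hid,
    fun a ha => ?_⟩
  refine ⟨subset_closure (hπ a), fun hi => ha ?_⟩
  have hev : ∀ᶠ s : ℝ in 𝓝 0, π a + s • (a - π a) ∈ P := by
    have hc : Continuous fun s : ℝ => π a + s • (a - π a) := by fun_prop
    refine hc.continuousAt.eventually_mem ?_
    simpa using mem_interior_iff_mem_nhds.1 hi
  obtain ⟨ε, hε, h⟩ := Metric.eventually_nhds_iff.1 hev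
  have := hin a _ (h (y := ε / 2) (by
    rw [Real.dist_eq, sub_zero, abs_of_pos (by positivity)]; linarith))
  rw [add_sub_cancel_left, inner_smul_right, real_inner_self_eq_norm_sq] at this
  have h0 : ‖a - π a‖ = 0 := by
    by_contra hne
    have : 0 < ‖a - π a‖ := lt_of_le_of_ne (norm_nonneg _) (Ne.symm hne)
    have : 0 < ε / 2 * ‖a - π a‖ ^ 2 := by positivity
    linarith
  rwa [← (sub_eq_zero.1 (norm_eq_zero.1 h0))] at hi

theorem surfDist_le_of_path [Finite ι] (hS : IsConicSurface (frontier P)) (hx : x ∈ frontier P)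
    (hy : y ∈ frontier P) {i j k : ι} (hix : ⟪n i, x⟫ = c i) (hip : c i ≤ ⟪n i, p⟫)
    (hkp : c k ≤ ⟪n k, p⟫) (hkq : c k ≤ ⟪n k, q⟫) (hjq : c j ≤ ⟪n j, q⟫) (hjy : ⟪n j, y⟫ = c j) :
    surfDist (frontier P) x y ≤ ‖x - p‖ + ‖p - q‖ + ‖q - y‖ := by
  obtain ⟨π, hL, hid, hfr⟩ := hP.exists_projection
  have out : ∀ a b : E, ∀ l, c l ≤ ⟪n l, a⟫ → c l ≤ ⟪n l, b⟫ → ∀ t ∈ Icc (0 : ℝ) 1,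
      π (AffineMap.lineMap a b t) ∈ frontier P := fun a b l ha hb t ht => by
    refine hfr _ fun hi => ?_
    have := hP.mem_interior_iff.1 hi l
    rw [AffineMap.lineMap_apply_module, inner_add_right, inner_smul_right, inner_smul_right] at this
    nlinarith [ht.1, ht.2]
  have mem : ∀ a b : E, ∀ l, c l ≤ ⟪n l, a⟫ → c l ≤ ⟪n l, b⟫ →
      π a ∈ frontier P ∧ π b ∈ frontier P := fun a b l ha hb =>
    ⟨by simpa using out a b l ha hb 0 (by simp), by simpa using out a b l ha hb 1 (by simp)⟩
  have key : ∀ a b : E, ∀ l, c l ≤ ⟪n l, a⟫ → c l ≤ ⟪n l, b⟫ →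
      surfDist (frontier P) (π a) (π b) ≤ ‖a - b‖ := fun a b l ha hb => by
    have hl : ∀ s ∈ Icc (0 : ℝ) 1, ∀ t ∈ Icc (0 : ℝ) 1,
        ‖π (AffineMap.lineMap a b s) - π (AffineMap.lineMap a b t)‖ ≤ ‖a - b‖ * |s - t| := by
      intro s _ t _
      refine (hL _ _).trans ?_
      rw [← dist_eq_norm, dist_lineMap_lineMap, Real.dist_eq, dist_eq_norm, mul_comm]
    have hc : Continuous π := by
      refine (LipschitzWith.of_dist_le_mul (K := 1) fun a b => ?_).continuous
      rw [dist_eq_norm, dist_eq_norm, NNReal.coe_one, one_mul]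
      exact hL a b
    have h1 := eVariationOn_le_of_lipschitz zero_le_one hl
    have h2 := intrinsicDist_le_eVariationOn (S := frontier P)
      (γ := fun t : ℝ => π (AffineMap.lineMap a b t)) zero_le_one
      (hc.comp AffineMap.lineMap_continuous).continuousOn (out a b l ha hb)
    have h3 := h2.trans h1
    simp only [AffineMap.lineMap_apply_zero, AffineMap.lineMap_apply_one, sub_zero, mul_one] at h3
    obtain ⟨m1, m2⟩ := mem a b l ha hb
    rw [← hS.ofReal_surfDist m1 m2] at h3
    exact (ENNReal.ofReal_le_ofReal_iff (norm_nonneg _)).1 h3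
  obtain ⟨-, mp⟩ := mem x p i hix.ge hip
  obtain ⟨mq, -⟩ := mem q y j hjq hjy.ge
  have k1 := key x p i hix.ge hip
  have k2 := key p q k hkp hkq
  have k3 := key q y j hjq hjy.ge
  rw [hid x (hP.frontier_subset hx)] at k1
  rw [hid y (hP.frontier_subset hy)] at k3
  have t1 := hS.surfDist_triangle hx mp mq
  have t2 := hS.surfDist_triangle hx mq hy
  linarith

end IsHPolytope

theorem le_sq_add_sq_div {t : ℝ} (ht : 0 < t) (u : ℝ) : u ≤ (u ^ 2 + t ^ 2) / (2 * t) := by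
  rw [le_div_iff₀ (by positivity)]
  nlinarith [sq_nonneg (u - t)]

theorem norm_sub_smul_le {t : ℝ} (ht : 0 < t) (s : ℝ) {a g : E} (ha : ‖a‖ = t) :
    ‖a - s • g‖ ≤ t - s * ⟪a, g⟫ / t + s ^ 2 * ‖g‖ ^ 2 / (2 * t) := by
  refine (le_sq_add_sq_div ht _).trans (le_of_eq ?_)
  rw [norm_sub_sq_real, norm_smul, inner_smul_right, ha, mul_pow, Real.norm_eq_abs, sq_abs]
  field_simp
  ring

/-- A first-order gain beats a second-order loss. -/
theorem exists_pos_mul_lt {A C : ℝ} (hA : 0 < A) (hC : 0 ≤ C) : ∃ s > 0, s ^ 2 * C < s * A := by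
  refine ⟨A / (C + 1), by positivity, ?_⟩
  have h : A / (C + 1) * C < A := by
    rw [div_mul_eq_mul_div, div_lt_iff₀ (by positivity)]
    nlinarith
  have hs : 0 < A / (C + 1) := by positivity
  nlinarith

namespace IsHPolytope

variable (hP : IsHPolytope P n c)
include hP

theorem add_eq_zero_of_surfDist_eq [Finite ι] [FiniteDimensional ℝ E]
    (hS : IsConicSurface (frontier P))
    (hw : IsWarped n c w) {t : ℝ} (ht : 0 < t) (ha : ‖a‖ = t) (hb : ‖b‖ = t)
    (hx : w + a ∈ frontier P) (hy : w + b ∈ frontier P) {i j : ι} (hiw : ⟪n i, w⟫ = c i)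
    (hia : ⟪n i, a⟫ = 0) (hjw : ⟪n j, w⟫ = c j) (hjb : ⟪n j, b⟫ = 0)
    (h : 2 * t ≤ surfDist (frontier P) (w + a) (w + b)) : a + b = 0 := by
  classical
  by_contra hne
  set V : Submodule ℝ E := Submodule.span ℝ {n i, n j} with hV
  obtain ⟨k, hkw, hk⟩ : ∃ k, ⟪n k, w⟫ = c k ∧ n k ∉ V := by
    by_contra! hall
    have hle : activeSpan n c w ≤ V := by
      rw [activeSpan, Submodule.span_le]
      rintro _ ⟨k, hk, rfl⟩
      exact hall k hk
    have h1 := Submodule.finrank_mono hle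
    have h2 : Module.finrank ℝ V ≤ 2 := by
      have := finrank_span_finset_le_card (R := ℝ) ({n i, n j} : Finset E)
      rw [Finset.coe_pair] at this
      exact this.trans Finset.card_le_two
    unfold IsWarped at hw
    lia
  set g := n k - V.starProjection (n k) with hg
  have hgV : g ∈ Vᗮ := Submodule.sub_starProjection_mem_orthogonal _
  have hgi : ⟪n i, g⟫ = 0 := hgV _ (Submodule.subset_span (by simp))
  have hgj : ⟪n j, g⟫ = 0 := hgV _ (Submodule.subset_span (by simp))
  have hg0 : g ≠ 0 := fun h0 => hk (by
    rw [sub_eq_zero.1 h0]; exact Submodule.starProjection_apply_mem _ _)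
  have hgk : ⟪n k, g⟫ = ‖g‖ ^ 2 := by
    have : ⟪V.starProjection (n k), g⟫ = 0 := hgV _ (Submodule.starProjection_apply_mem _ _)
    rw [← real_inner_self_eq_norm_sq]
    nth_rewrite 2 [hg]
    rw [inner_sub_left, this, sub_zero]
  have hgpos : 0 < ‖g‖ := norm_pos_iff.2 hg0
  rcases lt_or_ge ⟪a + b, g⟫ 0 with hlt | hge
  · obtain ⟨s, hs, hsC⟩ := exists_pos_mul_lt (A := -⟪a + b, g⟫ / t) (C := ‖g‖ ^ 2 / t)
      (div_pos (by linarith) ht) (by positivity)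
    have hm : ∀ l, ⟪n l, w⟫ = c l → ⟪n l, g⟫ = 0 → c l ≤ ⟪n l, w + (-s) • g⟫ := fun l h1 h2 => by
      rw [inner_add_right, inner_smul_right, h1, h2, mul_zero, add_zero]
    have hd := hP.surfDist_le_of_path hS hx hy (i := i) (j := j) (k := i) (p := w + (-s) • g)
      (q := w + (-s) • g) (by rw [inner_add_right, hiw, hia, add_zero]) (hm i hiw hgi)
      (hm i hiw hgi) (hm i hiw hgi) (hm j hjw hgj) (by rw [inner_add_right, hjw, hjb, add_zero])
    rw [sub_self, norm_zero, norm_sub_rev (w + (-s) • g), add_sub_add_left_eq_sub,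
      add_sub_add_left_eq_sub] at hd
    have e1 := norm_sub_smul_le ht (-s) (g := g) ha
    have e2 := norm_sub_smul_le ht (-s) (g := g) hb
    have e3 : -s * ⟪a, g⟫ / t + -s * ⟪b, g⟫ / t = s * (-⟪a + b, g⟫ / t) := by
      rw [inner_add_left]; ring
    have e4 : (-s) ^ 2 * ‖g‖ ^ 2 / (2 * t) + (-s) ^ 2 * ‖g‖ ^ 2 / (2 * t) =
        s ^ 2 * (‖g‖ ^ 2 / t) := by
      field_simp; ring
    linarith
  · set ε : ℝ := ‖g‖ ^ 2 / t with hε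
    have hε0 : 0 < ε := by positivity
    have hD : 0 < 2 * t - ‖a - b‖ := by
      have hpar := parallelogram_law_with_norm ℝ a b
      have : 0 < ‖a + b‖ := norm_pos_iff.2 hne
      rw [ha, hb] at hpar
      nlinarith [norm_nonneg (a - b)]
    obtain ⟨s, hs, hsC⟩ := exists_pos_mul_lt (A := ε * (2 * t - ‖a - b‖))
      (C := ‖g + ε • a‖ ^ 2 / (2 * t) + ‖g + ε • b‖ ^ 2 / (2 * t)) (by positivity) (by positivity)
    have hm : ∀ l a, ⟪n l, w⟫ = c l → ⟪n l, g⟫ = 0 → ⟪n l, a⟫ = 0 →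
        c l ≤ ⟪n l, w + s • (g + ε • a)⟫ := fun l a h1 h2 h3 => by
      rw [inner_add_right, inner_smul_right, inner_add_right, inner_smul_right, h1, h2, h3]
      simp
    have hmk : ∀ a, ‖a‖ = t → c k ≤ ⟪n k, w + s • (g + ε • a)⟫ := fun a ha => by
      rw [inner_add_right, inner_smul_right, inner_add_right, inner_smul_right, hkw, hgk]
      have h1 := (abs_le.1 (abs_real_inner_le_norm (n k) a)).1
      rw [hP.norm_eq_one, ha, one_mul] at h1
      have h2 : ε * t = ‖g‖ ^ 2 := by rw [hε]; field_simp
      have h3 : 0 ≤ s * (‖g‖ ^ 2 + ε * ⟪n k, a⟫) := by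
        refine mul_nonneg hs.le ?_
        nlinarith
      linarith
    have hd := hP.surfDist_le_of_path hS hx hy (i := i) (j := j) (k := k)
      (p := w + s • (g + ε • a)) (q := w + s • (g + ε • b))
      (by rw [inner_add_right, hiw, hia, add_zero]) (hm i a hiw hgi hia) (hmk a ha) (hmk b hb)
      (hm j b hjw hgj hjb) (by rw [inner_add_right, hjw, hjb, add_zero])
    rw [norm_sub_rev (w + s • (g + ε • b)) (w + b), add_sub_add_left_eq_sub,
      add_sub_add_left_eq_sub, add_sub_add_left_eq_sub] at hd
    have e0 : ‖s • (g + ε • a) - s • (g + ε • b)‖ = s * (ε * ‖a - b‖) := by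
      rw [← smul_sub, add_sub_add_left_eq_sub, ← smul_sub, norm_smul, norm_smul,
        Real.norm_of_nonneg hs.le, Real.norm_of_nonneg hε0.le]
    have e1 := norm_sub_smul_le ht s (g := g + ε • a) ha
    have e2 := norm_sub_smul_le ht s (g := g + ε • b) hb
    have e3 : s * ⟪a, g + ε • a⟫ / t + s * ⟪b, g + ε • b⟫ / t =
        s * ⟪a + b, g⟫ / t + s * (2 * ε * t) := by
      rw [inner_add_left, inner_add_right, inner_add_right, inner_smul_right, inner_smul_right,
        real_inner_self_eq_norm_sq, real_inner_self_eq_norm_sq, ha, hb]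
      field_simp; ring
    have e4 : 0 ≤ s * ⟪a + b, g⟫ / t := by positivity
    rw [e0] at hd
    have e5 : s ^ 2 * ‖g + ε • a‖ ^ 2 / (2 * t) + s ^ 2 * ‖g + ε • b‖ ^ 2 / (2 * t) =
      s ^ 2 * (‖g + ε • a‖ ^ 2 / (2 * t) + ‖g + ε • b‖ ^ 2 / (2 * t)) := by ring
    nlinarith

/-- A shortest path that starts at a non-warped point meets no warped point before its end. -/
theorem eq_of_isBtw_of_isWarped [Finite ι] [FiniteDimensional ℝ E]
    (hS : IsConicSurface (frontier P))
    (hv : v ∈ frontier P) (hvw : ¬ IsWarped n c v) (hw : w ∈ frontier P) (hww : IsWarped n c w)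
    (hy : y ∈ frontier P) (h : IsBtw (frontier P) v w y) : y = w := by
  by_contra hyw
  obtain ⟨γ, hγ, s₁, hs₁, hγs₁⟩ := hS.exists_isGeodesic_through hv hw hy h
  have hcont := hγ.continuousOn hS
  have hL : 0 < surfDist (frontier P) v y := by
    refine lt_of_le_of_ne (surfDist_nonneg _ _) fun h0 => hyw ?_
    have h1 := hS.eq_of_surfDist_le_zero hv hw (by
      have := surfDist_nonneg (S := frontier P) w y
      unfold IsBtw at h; linarith)
    have h2 := hS.eq_of_surfDist_le_zero hv hy h0.symm.le
    rw [← h1, ← h2]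
  set L := surfDist (frontier P) v y with hLdef
  have hs₁' : s₁ < 1 := lt_of_le_of_ne hs₁.2 fun e => hyw (by rw [← hγs₁, e, hγ.one])
  set T := {t ∈ Icc (0 : ℝ) s₁ | IsWarped n c (γ t)} with hT
  have hTne : s₁ ∈ T := ⟨⟨hs₁.1, le_rfl⟩, by rwa [hγs₁]⟩
  have hTb : BddBelow T := ⟨0, fun t ht => ht.1.1⟩
  set s := sInf T with hs
  have hs0 : 0 ≤ s := le_csInf ⟨_, hTne⟩ fun t ht => ht.1.1
  have hss₁ : s ≤ s₁ := csInf_le hTb hTne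
  have hsI : s ∈ Icc (0 : ℝ) 1 := ⟨hs0, hss₁.trans hs₁.2⟩
  have hsw : IsWarped n c (γ s) := by
    by_contra hn
    obtain ⟨r, hr, hnw⟩ := exists_forall_not_isWarped (hP.inner_le (hγ.mem s hsI)) hn
    obtain ⟨t, htT, hts⟩ := exists_lt_of_csInf_lt (⟨_, hTne⟩ : T.Nonempty)
      (show sInf T < s + r / L from lt_add_of_pos_right _ (by positivity))
    have hst : s ≤ t := csInf_le hTb htT
    refine hnw (γ t) ?_ htT.2
    refine (hγ.norm_sub_le hS ⟨htT.1.1, htT.1.2.trans hs₁.2⟩ hsI).trans_lt ?_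
    rw [← hLdef, abs_of_nonneg (by linarith), ← lt_div_iff₀' hL]
    linarith
  have hspos : 0 < s := lt_of_le_of_ne hs0 fun e => hvw (by rw [← hγ.zero, e]; exact hsw)
  have hslt : s < 1 := hss₁.trans_lt hs₁'
  have hwS := hγ.mem s hsI
  obtain ⟨r, hr, hact⟩ := exists_forall_active n c (γ s) (hP.inner_le hwS)
  obtain ⟨r', hr', hdist⟩ := hS.exists_surfDist_eq hwS
  obtain ⟨τ, hτ0, hτ⟩ : ∃ τ > 0, τ < s ∧ τ < 1 - s ∧ L * τ < r ∧ L * τ < r' := by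
    obtain ⟨τ, h0, h1⟩ := exists_between (show 0 < min (min s (1 - s)) (min (r / L) (r' / L)) from
      lt_min (lt_min hspos (by linarith)) (lt_min (by positivity) (by positivity)))
    simp only [lt_min_iff] at h1
    exact ⟨τ, h0, h1.1.1, h1.1.2, (lt_div_iff₀' hL).1 h1.2.1, (lt_div_iff₀' hL).1 h1.2.2⟩
  have near : ∀ t ∈ Icc (0 : ℝ) 1, |t - s| = τ → γ t ∈ frontier P ∧ ‖γ t - γ s‖ = L * τ ∧
      ∃ i, ⟪n i, γ s⟫ = c i ∧ ⟪n i, γ t - γ s⟫ = 0 := by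
    intro t ht hts
    have hm := hγ.mem t ht
    have hle := hγ.norm_sub_le hS ht hsI
    rw [← hLdef, hts] at hle
    obtain ⟨i, hi⟩ := (hP.mem_frontier_iff.1 hm).2
    have hi' := hact _ (hle.trans_lt hτ.2.2.1) i hi
    refine ⟨hm, ?_, i, hi', by rw [inner_sub_right, hi, hi', sub_self]⟩
    rw [norm_sub_rev, ← hdist _ hm (hle.trans_lt hτ.2.2.2), hγ.dist s hsI t ht, abs_sub_comm, hts]
  have hI1 : s - τ ∈ Icc (0 : ℝ) 1 := ⟨by linarith, by linarith⟩
  have hI2 : s + τ ∈ Icc (0 : ℝ) 1 := ⟨by linarith, by linarith⟩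
  obtain ⟨m1, d1, i, hi, hi0⟩ := near (s - τ) hI1 (by
    rw [sub_sub_cancel_left, abs_neg, abs_of_pos hτ0])
  obtain ⟨m2, d2, j, hj, hj0⟩ := near (s + τ) hI2 (by rw [add_sub_cancel_left, abs_of_pos hτ0])
  have hzero := hP.add_eq_zero_of_surfDist_eq hS hsw (t := L * τ) (by positivity) d1 d2
    (by rwa [add_sub_cancel]) (by rwa [add_sub_cancel]) hi hi0 hj hj0 (by
      rw [add_sub_cancel, add_sub_cancel, hγ.dist _ hI1 _ hI2, abs_sub_comm,
        show s + τ - (s - τ) = 2 * τ by ring, abs_of_pos (by positivity)]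
      exact le_of_eq (by ring))
  have hmem : s - τ ∈ T := by
    refine ⟨⟨hI1.1, by linarith⟩, hsw.trans (Submodule.finrank_mono
        (activeSpan_mono fun k hk => ?_))⟩
    have h1 := hP.inner_le m1 k
    have h2 := hP.inner_le m2 k
    have h3 := congrArg (fun z => ⟪n k, z⟫) hzero
    simp only [inner_add_right, inner_sub_right, inner_zero_right] at h3
    linarith
  have := csInf_le hTb hmem
  linarith

end IsHPolytope
end Shortcuts

section Charts

variable {E : Type*} [NormedAddCommGroup E] [InnerProductSpace ℝ E] {P : Set E} {ι : Type*}
  {n : ι → E} {c : ι → ℝ} {x y z q : E} {i j : ι}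

/-- The reflection that unfolds the facet `j` into the plane of the facet `i`. -/
noncomputable def unfoldMap (n : ι → E) (c : ι → ℝ) (i j : ι) : E ≃ᵃⁱ[ℝ] E :=
  AffineIsometryEquiv.mk' (fun y => (ℝ ∙ (n i + n j))ᗮ.reflection y +
      (2 * (c i + c j) / ‖n i + n j‖ ^ 2) • (n i + n j))
    (ℝ ∙ (n i + n j))ᗮ.reflection 0 fun y => by simp

theorem unfoldMap_apply (y : E) : unfoldMap n c i j y =
    y - (2 * (⟪n i + n j, y⟫ - (c i + c j)) / ‖n i + n j‖ ^ 2) • (n i + n j) := by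
  rw [unfoldMap, AffineIsometryEquiv.coe_mk', Submodule.reflection_orthogonal_apply,
    Submodule.reflection_singleton_apply]
  simp only [RCLike.ofReal_real_eq_id, id]
  module

theorem unfoldMap_eq_self (hi : ⟪n i, y⟫ = c i) (hj : ⟪n j, y⟫ = c j) :
    unfoldMap n c i j y = y := by
  rw [unfoldMap_apply, inner_add_left, hi, hj]
  simp

theorem inner_unfoldMap (hni : ‖n i‖ = 1) (hnj : ‖n j‖ = 1) (hne : n i + n j ≠ 0) (y : E) :
    ⟪n i, unfoldMap n c i j y⟫ - c i = -(⟪n j, y⟫ - c j) ∧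
      ⟪n j, unfoldMap n c i j y⟫ - c j = -(⟪n i, y⟫ - c i) := by
  have h0 : ‖n i + n j‖ ^ 2 ≠ 0 := pow_ne_zero 2 (norm_ne_zero_iff.2 hne)
  have h1 : ⟪n i, n i + n j⟫ = ‖n i + n j‖ ^ 2 / 2 := by
    rw [norm_add_sq_real, inner_add_right, real_inner_self_eq_norm_sq, hni, hnj]; ring
  have h2 : ⟪n j, n i + n j⟫ = ‖n i + n j‖ ^ 2 / 2 := by
    rw [norm_add_sq_real, inner_add_right, real_inner_self_eq_norm_sq, hni, hnj,
      real_inner_comm (n i)]; ring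
  rw [unfoldMap_apply, inner_sub_right, inner_sub_right, inner_smul_right, inner_smul_right, h1, h2,
    inner_add_left]
  constructor <;> field_simp <;> ring

theorem unfoldMap_unfoldMap (hne : n i + n j ≠ 0) (y : E) :
    unfoldMap n c i j (unfoldMap n c i j y) = y := by
  have h0 : ‖n i + n j‖ ^ 2 ≠ 0 := pow_ne_zero 2 (norm_ne_zero_iff.2 hne)
  have h : 2 * (⟪n i + n j, unfoldMap n c i j y⟫ - (c i + c j)) / ‖n i + n j‖ ^ 2 =
      -(2 * (⟪n i + n j, y⟫ - (c i + c j)) / ‖n i + n j‖ ^ 2) := by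
    rw [unfoldMap_apply, inner_sub_right, inner_smul_right, real_inner_self_eq_norm_sq]
    field_simp; ring
  rw [unfoldMap_apply (unfoldMap n c i j y), h, unfoldMap_apply]
  module

theorem norm_unfoldMap_sub (x y : E) :
    ‖unfoldMap n c i j x - unfoldMap n c i j y‖ = ‖x - y‖ := by
  rw [← dist_eq_norm, ← dist_eq_norm, AffineIsometryEquiv.dist_map]

namespace IsHPolytope

variable (hP : IsHPolytope P n c)
include hP

/-- At a non-warped boundary point, two active constraints imply all the active ones. -/
theorem exists_generators [Finite ι] [FiniteDimensional ℝ E] (hz : z ∈ frontier P)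
    (hw : ¬ IsWarped n c z) : ∃ i j, ⟪n i, z⟫ = c i ∧ ⟪n j, z⟫ = c j ∧ n i + n j ≠ 0 ∧
      ∀ k, ⟪n k, z⟫ = c k → ∃ α β : ℝ, 0 ≤ α ∧ 0 ≤ β ∧ n k = α • n i + β • n j := by
  obtain ⟨q, hq⟩ := hP.exists_lt
  obtain ⟨i₀, hi₀⟩ := (hP.mem_frontier_iff.1 hz).2
  set μ : ι → ℝ := fun k => -⟪n k, q - z⟫ with hμ
  have hμpos : ∀ k, ⟪n k, z⟫ = c k → 0 < μ k := fun k hk => by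
    rw [hμ]; simp only [inner_sub_right, hk]; linarith [hq k]
  set V := activeSpan n c z with hV
  set W : Submodule ℝ E := V ⊓ (ℝ ∙ (q - z))ᗮ with hW
  have hmemW : ∀ u, u ∈ W ↔ u ∈ V ∧ ⟪u, q - z⟫ = 0 := fun u => by
    rw [hW, Submodule.mem_inf, Submodule.mem_orthogonal_singleton_iff_inner_left]
  have hlt : W < V := by
    refine lt_of_le_of_ne inf_le_left fun e => ?_
    have : n i₀ ∈ W := e ▸ mem_activeSpan hi₀
    have h2 := hμpos i₀ hi₀
    rw [hμ] at h2
    simp only [((hmemW _).1 this).2] at h2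
    linarith
  have hW1 : Module.finrank ℝ W ≤ 1 := by
    exact Nat.le_of_lt_succ ((Submodule.finrank_lt_finrank_of_lt hlt).trans_le
      (Nat.le_of_lt_succ (not_le.1 hw)))
  obtain ⟨e, he⟩ := finrank_le_one_iff.1 hW1
  set ν : ι → E := fun k => (μ k)⁻¹ • n k with hν
  have hs : ∀ k, ∃ s : ℝ, ⟪n k, z⟫ = c k → ν k = ν i₀ + s • (e : E) := by
    intro k
    by_cases hk : ⟪n k, z⟫ = c k
    · have h1 := (hμpos k hk).ne'
      have h2 := (hμpos i₀ hi₀).ne'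
      have hm : ν k - ν i₀ ∈ W := by
        refine (hmemW _).2 ⟨V.sub_mem (V.smul_mem _ (mem_activeSpan hk))
          (V.smul_mem _ (mem_activeSpan hi₀)), ?_⟩
        have e1 : ⟪n k, q - z⟫ = -μ k := by simp [hμ]
        have e2 : ⟪n i₀, q - z⟫ = -μ i₀ := by simp [hμ]
        rw [inner_sub_left, hν, real_inner_smul_left, real_inner_smul_left, e1, e2]
        field_simp; ring
      obtain ⟨s, hs⟩ := he ⟨_, hm⟩
      refine ⟨s, fun _ => ?_⟩
      have := congrArg Subtype.val hs
      simp only [Submodule.coe_smul] at this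
      rw [this]; abel
    · exact ⟨0, fun h => absurd h hk⟩
  choose s hs using hs
  obtain ⟨i, hi, hmin⟩ := exists_min_image {k | ⟪n k, z⟫ = c k} s (toFinite _) ⟨i₀, hi₀⟩
  obtain ⟨j, hj, hmax⟩ := exists_max_image {k | ⟪n k, z⟫ = c k} s (toFinite _) ⟨i₀, hi₀⟩
  refine ⟨i, j, hi, hj, fun h0 => ?_, fun k hk => ?_⟩
  · have h1 := hμpos i hi
    have h2 := hμpos j hj
    have h3 := congrArg (fun u => ⟪u, q - z⟫) h0
    simp only [inner_add_left, inner_zero_left] at h3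
    simp only [hμ] at h1 h2
    linarith
  · have hseg : s k ∈ segment ℝ (s i) (s j) := by
      rw [segment_eq_Icc (hmin j hj)]
      exact ⟨hmin k hk, hmax k hk⟩
    obtain ⟨a, b, ha, hb, hab, hk'⟩ := hseg
    have h1 := hμpos i hi
    have h2 := hμpos j hj
    have h3 := hμpos k hk
    refine ⟨μ k * a * (μ i)⁻¹, μ k * b * (μ j)⁻¹, by positivity, by positivity, ?_⟩
    have hνk : ν k = a • ν i + b • ν j := by
      obtain rfl : b = 1 - a := by linarith
      rw [hs k hk, hs i hi, hs j hj, ← hk', smul_eq_mul, smul_eq_mul]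
      module
    calc n k = μ k • ν k := by rw [hν, smul_inv_smul₀ h3.ne']
      _ = _ := by rw [hνk, hν]; module

theorem exists_isFlatChart [Finite ι] [FiniteDimensional ℝ E] (hS : IsConicSurface (frontier P))
    (hz : z ∈ frontier P) (hw : ¬ IsWarped n c z) : ∃ r φ i j, IsFlatChart (frontier P) z r φ ∧
      ∀ y, φ y = y ∨ φ y = unfoldMap n c i j y := by
  classical
  obtain ⟨i, j, hi, hj, hne, hgen⟩ := hP.exists_generators hz hw
  obtain ⟨r, hr, hina⟩ := exists_forall_inner_lt n c z
  have hzi := hP.inner_le hz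
  have memP : ∀ x, ‖x - z‖ < r → ⟪n i, x⟫ ≤ c i → ⟪n j, x⟫ ≤ c j → x ∈ P := by
    intro x hx h1 h2
    refine (hP.mem_iff x).2 fun k => ?_
    rcases (hzi k).lt_or_eq with hk | hk
    · exact (hina x hx k hk).le
    · obtain ⟨α, β, hα, hβ, e⟩ := hgen k hk
      have e1 : c k = α * c i + β * c j := by
        rw [← hk, e, inner_add_left, real_inner_smul_left, real_inner_smul_left, hi, hj]
      rw [e, inner_add_left, real_inner_smul_left, real_inner_smul_left, e1]
      nlinarith
  have memS : ∀ x ∈ frontier P, ‖x - z‖ < r → ⟪n i, x⟫ = c i ∨ ⟪n j, x⟫ = c j := by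
    intro x hx hxz
    by_contra! hcon
    obtain ⟨k, hk⟩ := (hP.mem_frontier_iff.1 hx).2
    have hkz : ⟪n k, z⟫ = c k := by
      by_contra h
      exact (hina x hxz k (lt_of_le_of_ne (hzi k) h)).ne hk
    obtain ⟨α, β, hα, hβ, e⟩ := hgen k hkz
    have e1 : c k = α * c i + β * c j := by
      rw [← hkz, e, inner_add_left, real_inner_smul_left, real_inner_smul_left, hi, hj]
    rw [e, inner_add_left, real_inner_smul_left, real_inner_smul_left, e1] at hk
    have h1 := lt_of_le_of_ne (hP.inner_le hx i) hcon.1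
    have h2 := lt_of_le_of_ne (hP.inner_le hx j) hcon.2
    have hα0 : α = 0 := by
      by_contra h
      have : 0 < α := lt_of_le_of_ne hα (Ne.symm h)
      nlinarith
    have hβ0 : β = 0 := by
      by_contra h
      have : 0 < β := lt_of_le_of_ne hβ (Ne.symm h)
      nlinarith
    have := hP.norm_eq_one k
    rw [e, hα0, hβ0] at this
    simp at this
  set T := unfoldMap n c i j with hT
  have hTz : T z = z := unfoldMap_eq_self hi hj
  have hTn : ∀ x, ‖T x - z‖ = ‖x - z‖ := fun x => by
    nth_rewrite 1 [← hTz]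
    exact norm_unfoldMap_sub x z
  have hTi : ∀ x, ⟪n i, T x⟫ - c i = -(⟪n j, x⟫ - c j) ∧ ⟪n j, T x⟫ - c j = -(⟪n i, x⟫ - c i) :=
    inner_unfoldMap (hP.norm_eq_one i) (hP.norm_eq_one j) hne
  set φ : E → E := fun y => if ⟪n i, y⟫ = c i then y else T y with hφ
  have hφi : ∀ y, ⟪n i, y⟫ = c i → φ y = y := fun y h => if_pos h
  have hφj : ∀ y, ⟪n j, y⟫ = c j → φ y = T y := fun y h => by
    by_cases h' : ⟪n i, y⟫ = c i
    · rw [hφi y h', hT, unfoldMap_eq_self h' h]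
    · exact if_neg h'
  have seg : ∀ l x y, x ∈ P → y ∈ P → ⟪n l, x⟫ = c l → ⟪n l, y⟫ = c l →
      surfDist (frontier P) x y = ‖x - y‖ := fun l x y hx hy h1 h2 =>
    hS.surfDist_eq_of_segment_subset (hP.segment_subset_frontier hx hy h1 h2)
  have cross : ∀ x ∈ frontier P, ‖x - z‖ < r / 3 → ∀ y ∈ frontier P, ‖y - z‖ < r / 3 →
      ⟪n i, x⟫ = c i → ⟪n j, y⟫ = c j → surfDist (frontier P) x y = ‖x - T y‖ := by
    intro x hx hxz y hy hyz hxi hyj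
    have hxP := hP.frontier_subset hx
    have hyP := hP.frontier_subset hy
    have hTp : ∀ p, ⟪n i, p⟫ = c i → ⟪n j, p⟫ = c j → ‖p - y‖ = ‖p - T y‖ := fun p h1 h2 => by
      rw [← norm_unfoldMap_sub (n := n) (c := c) (i := i) (j := j) p y, unfoldMap_eq_self h1 h2]
    have upper : surfDist (frontier P) x y ≤ ‖x - T y‖ := by
      obtain ⟨t, ht, hft⟩ : ∃ t ∈ Icc (0 : ℝ) 1, ⟪n j, AffineMap.lineMap x (T y) t⟫ = c j := by
        have hc : ContinuousOn (fun t : ℝ => ⟪n j, AffineMap.lineMap x (T y) t⟫) (Icc 0 1) :=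
          (continuous_const.inner AffineMap.lineMap_continuous).continuousOn
        refine intermediate_value_Icc zero_le_one hc ⟨?_, ?_⟩
        · simpa using hP.inner_le hx j
        · simp only [AffineMap.lineMap_apply_one]
          linarith [(hTi y).2, hP.inner_le hy i]
      set p : E := AffineMap.lineMap x (T y) t with hp
      have hpi : ⟪n i, p⟫ = c i := by
        have : ⟪n i, T y⟫ = c i := by linarith [(hTi y).1]
        rw [hp, AffineMap.lineMap_apply_module, inner_add_right, inner_smul_right, inner_smul_right,
          hxi, this]
        ring
      have hpz : ‖p - z‖ < r := by
        have h1 : x ∈ ball z r := by rw [mem_ball, dist_eq_norm]; linarith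
        have h2 : T y ∈ ball z r := by rw [mem_ball, dist_eq_norm, hTn]; linarith
        have := (convex_ball z r).lineMap_mem h1 h2 ht
        rwa [mem_ball, dist_eq_norm] at this
      have hpP := memP p hpz hpi.le hft.le
      have hpS := hP.mem_frontier_iff.2 ⟨hpP, i, hpi⟩
      refine (hS.surfDist_triangle hx hpS hy).trans ?_
      rw [seg i x p hxP hpP hxi hpi, seg j p y hpP hyP hft hyj, hTp p hpi hft, ← dist_eq_norm,
        ← dist_eq_norm, ← dist_eq_norm, hp, dist_left_lineMap, dist_lineMap_right,
        Real.norm_of_nonneg ht.1, Real.norm_of_nonneg (by linarith [ht.2])]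
      exact le_of_eq (by ring)
    refine upper.antisymm ?_
    obtain ⟨γ, hγ⟩ := hS.exists_isGeodesic hx hy
    have hγz : ∀ t ∈ Icc (0 : ℝ) 1, ‖γ t - z‖ < r := fun t ht => by
      have h1 := hγ.norm_sub_le hS ht (left_mem_Icc.2 zero_le_one)
      rw [hγ.zero, sub_zero, abs_of_nonneg ht.1] at h1
      have h2 : surfDist (frontier P) x y * t ≤ surfDist (frontier P) x y :=
        mul_le_of_le_one_right (surfDist_nonneg _ _) ht.2
      have h3 : ‖x - T y‖ ≤ ‖x - z‖ + ‖T y - z‖ := by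
        rw [norm_sub_rev (T y)]; exact norm_sub_le_norm_sub_add_norm_sub _ _ _
      have h4 := norm_sub_le_norm_sub_add_norm_sub (γ t) x z
      rw [hTn] at h3
      linarith
    have hcont := hγ.continuousOn hS
    obtain ⟨t, ht, hft⟩ : ∃ t ∈ Icc (0 : ℝ) 1,
        (⟪n i, γ t⟫ - c i) - (⟪n j, γ t⟫ - c j) = 0 := by
      have hc : ContinuousOn (fun t : ℝ => (⟪n i, γ t⟫ - c i) - (⟪n j, γ t⟫ - c j)) (Icc 0 1) :=
        ((continuousOn_const.inner hcont).sub continuousOn_const).sub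
          ((continuousOn_const.inner hcont).sub continuousOn_const)
      refine intermediate_value_Icc' zero_le_one hc ⟨?_, ?_⟩
      · simp only [hγ.one]
        linarith [hP.inner_le hy i]
      · simp only [hγ.zero]
        linarith [hP.inner_le hx j]
    have hpS := hγ.mem t ht
    have hp : ⟪n i, γ t⟫ = c i ∧ ⟪n j, γ t⟫ = c j := by
      rcases memS _ hpS (hγz t ht) with h | h <;> constructor <;> linarith
    have hb := hγ.isBtw ht
    have h1 := hS.norm_sub_le_surfDist hx hpS
    have h2 := hS.norm_sub_le_surfDist hpS hy
    rw [hTp _ hp.1 hp.2] at h2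
    have h3 := norm_sub_le_norm_sub_add_norm_sub x (γ t) (T y)
    unfold IsBtw at hb
    linarith
  refine ⟨r / 3, φ, i, j, ⟨by positivity, ?_, ?_⟩, fun y => ?_⟩
  · intro x hx hxz y hy hyz
    have hxP := hP.frontier_subset hx
    have hyP := hP.frontier_subset hy
    rcases memS x hx (by linarith) with h1 | h1 <;> rcases memS y hy (by linarith) with h2 | h2
    · rw [hφi x h1, hφi y h2, seg i x y hxP hyP h1 h2]
    · rw [hφi x h1, hφj y h2, cross x hx hxz y hy hyz h1 h2]
    · rw [hφj x h1, hφi y h2, surfDist_comm, cross y hy hyz x hx hxz h2 h1, norm_sub_rev]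
    · rw [hφj x h1, hφj y h2, norm_unfoldMap_sub, seg j x y hxP hyP h1 h2]
  · intro x hx hxz a ha
    rw [hφi z hi] at ha ⊢
    set u := z + a • (φ x - z) with hu
    have huz : ‖u - z‖ < r / 3 := by rwa [hu, add_sub_cancel_left]
    have hφx : ⟪n i, φ x⟫ = c i := by
      rcases memS x hx (by linarith) with h | h
      · rw [hφi x h, h]
      · rw [hφj x h]; linarith [(hTi x).1]
    have hui : ⟪n i, u⟫ = c i := by
      rw [hu, inner_add_right, inner_smul_right, inner_sub_right, hφx, hi]; ring
    rcases le_total ⟪n j, u⟫ (c j) with h | h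
    · exact ⟨u, hP.mem_frontier_iff.2 ⟨memP u (by linarith) hui.le h, i, hui⟩, huz, hφi u hui⟩
    · have h1 : ⟪n j, T u⟫ = c j := by linarith [(hTi u).2]
      have h2 : ‖T u - z‖ < r / 3 := by rwa [hTn]
      refine ⟨T u, hP.mem_frontier_iff.2 ⟨memP (T u) (by linarith) ?_ h1.le, j, h1⟩, h2, ?_⟩
      · linarith [(hTi u).1]
      · rw [hφj _ h1, hT, unfoldMap_unfoldMap hne]
  · by_cases h : ⟪n i, y⟫ = c i
    · exact Or.inl (if_pos h)
    · exact Or.inr (if_neg h)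

end IsHPolytope
end Charts

section Developing

variable {E : Type*} [NormedAddCommGroup E] [InnerProductSpace ℝ E] {P : Set E} {ι : Type*}
  {n : ι → E} {c : ι → ℝ} {v w x y z q : E} {γ : ℝ → E}

/-- The group generated by the unfolding reflections. -/
noncomputable def unfoldGroup (n : ι → E) (c : ι → ℝ) : Subgroup (E ≃ᵃⁱ[ℝ] E) :=
  (FreeGroup.lift fun p : ι × ι => unfoldMap n c p.1 p.2).range

theorem inv_apply_self (g : E ≃ᵃⁱ[ℝ] E) (x : E) : g⁻¹ (g x) = x :=
  g.symm_apply_apply x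

theorem unfoldMap_mem_unfoldGroup (i j : ι) : unfoldMap n c i j ∈ unfoldGroup n c :=
  ⟨FreeGroup.of (i, j), by simp⟩

theorem countable_unfoldGroup [Countable ι] : Countable (unfoldGroup n c) :=
  (countable_range (FreeGroup.lift fun p : ι × ι => unfoldMap n c p.1 p.2)).to_subtype

theorem exists_affineMap_eqOn {f : ℝ → E} {L a b : ℝ} (hab : a < b)
    (h : ∀ s ∈ Icc a b, ∀ t ∈ Icc a b, ‖f s - f t‖ = L * |s - t|) :
    ∃ ℓ : ℝ →ᵃ[ℝ] E, ∀ t ∈ Icc a b, ℓ t = f t := by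
  have hba : 0 < b - a := by linarith
  refine ⟨(AffineMap.lineMap (f a) (f b)).comp
      (AffineMap.lineMap (-a / (b - a)) ((1 - a) / (b - a))),
    fun t ht => ?_⟩
  have e : (AffineMap.lineMap (-a / (b - a)) ((1 - a) / (b - a)) t : ℝ) = (t - a) / (b - a) := by
    rw [AffineMap.lineMap_apply, vsub_eq_sub, vadd_eq_add, smul_eq_mul]
    field_simp; ring
  rw [AffineMap.comp_apply, e]
  symm
  have ha := left_mem_Icc.2 hab.le
  have hb := right_mem_Icc.2 hab.le
  apply eq_lineMap_of_dist_eq_mul_of_dist_eq_mul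
  · rw [dist_eq_norm, dist_eq_norm, h a ha t ht, h a ha b hb, abs_sub_comm, abs_sub_comm a b,
      abs_of_pos hba, abs_of_nonneg (by linarith [ht.1])]
    field_simp
  · rw [dist_eq_norm, dist_eq_norm, h t ht b hb, h a ha b hb, abs_sub_comm, abs_sub_comm a b,
      abs_of_pos hba, abs_of_nonneg (by linarith [ht.2])]
    field_simp; ring

theorem exists_mem_forall_eq {Γ : Subgroup (E ≃ᵃⁱ[ℝ] E)} [Countable Γ] {ℓ ℓ' : ℝ →ᵃ[ℝ] E} {a b : ℝ}
    (hab : a < b) (h : ∀ t ∈ Icc a b, ∃ g ∈ Γ, γ t = g (ℓ t))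
    (h' : ∀ t ∈ Icc a b, ∃ g ∈ Γ, γ t = g (ℓ' t)) : ∃ g ∈ Γ, ∀ t, ℓ' t = g (ℓ t) := by
  by_contra! hcon
  have hsub : ∀ g : Γ, {t | ℓ' t = (g : E ≃ᵃⁱ[ℝ] E) (ℓ t)}.Subsingleton := by
    intro g s hs t ht
    by_contra hst
    obtain ⟨u, hu⟩ := hcon g g.2
    refine hu ?_
    have hts : t - s ≠ 0 := sub_ne_zero.2 (Ne.symm hst)
    have e : u = AffineMap.lineMap s t ((u - s) / (t - s)) := by
      rw [AffineMap.lineMap_apply, vsub_eq_sub, vadd_eq_add, smul_eq_mul]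
      field_simp; ring
    rw [e, AffineMap.apply_lineMap, AffineMap.apply_lineMap, show ℓ' s = _ from hs,
      show ℓ' t = _ from ht]
    exact ((g : E ≃ᵃⁱ[ℝ] E).toAffineEquiv.apply_lineMap _ _ _).symm
  have hcov : Icc a b ⊆ ⋃ g : Γ, {t | ℓ' t = (g : E ≃ᵃⁱ[ℝ] E) (ℓ t)} := by
    intro t ht
    obtain ⟨g, hg, e⟩ := h t ht
    obtain ⟨g', hg', e'⟩ := h' t ht
    refine mem_iUnion.2 ⟨⟨g'⁻¹ * g, Γ.mul_mem (Γ.inv_mem hg') hg⟩, ?_⟩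
    change ℓ' t = (g'⁻¹ * g) (ℓ t)
    rw [AffineIsometryEquiv.coe_mul, Function.comp_apply, ← e, e', inv_apply_self]
  have hc : (Icc a b).Countable :=
    (countable_iUnion fun g => (hsub g).finite.countable).mono hcov
  have h0 := hc.measure_zero MeasureTheory.volume
  rw [Real.volume_Icc, ENNReal.ofReal_eq_zero] at h0
  linarith

namespace IsHPolytope

variable (hP : IsHPolytope P n c)
include hP

theorem exists_local_affineMap [Finite ι] [FiniteDimensional ℝ E] (hS : IsConicSurface (frontier P))
    (hγ : IsGeodesic (frontier P) v w γ) {t₀ : ℝ} (ht₀ : t₀ ∈ Icc (0 : ℝ) 1)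
    (hnw : t₀ ∈ Ioo (0 : ℝ) 1 → ¬ IsWarped n c (γ t₀)) :
    ∃ δ > 0, ∃ ℓ : ℝ →ᵃ[ℝ] E, ∀ t ∈ Icc (0 : ℝ) 1, |t - t₀| ≤ δ → ∃ g ∈ unfoldGroup n c,
      γ t = g (ℓ t) := by
  set L := surfDist (frontier P) v w with hL
  have hL0 : 0 ≤ L := surfDist_nonneg _ _
  have hzS := hγ.mem t₀ ht₀
  have small : ∀ r > 0, ∃ δ > 0, ∀ t ∈ Icc (0 : ℝ) 1, |t - t₀| ≤ δ → ‖γ t - γ t₀‖ < r := by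
    intro r hr
    refine ⟨r / (L + 1), by positivity, fun t ht htt => (hγ.norm_sub_le hS ht ht₀).trans_lt ?_⟩
    rw [le_div_iff₀ (by positivity)] at htt
    rcases (abs_nonneg (t - t₀)).eq_or_lt with h | h
    · rw [← h, mul_zero]; exact hr
    · nlinarith
  obtain ⟨δ, hδ, f, hf, hg⟩ : ∃ δ > 0, ∃ f : ℝ → E, (∀ s ∈ Icc (0 : ℝ) 1, ∀ t ∈ Icc (0 : ℝ) 1,
      |s - t₀| ≤ δ → |t - t₀| ≤ δ → ‖f s - f t‖ = L * |s - t|) ∧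
      ∀ t, ∃ g ∈ unfoldGroup n c, γ t = g (f t) := by
    by_cases hin : t₀ ∈ Ioo (0 : ℝ) 1
    · obtain ⟨r, φ, i, j, hφ, hφT⟩ := hP.exists_isFlatChart hS hzS (hnw hin)
      obtain ⟨δ, hδ, hr⟩ := small r hφ.pos
      refine ⟨δ, hδ, fun t => φ (γ t), fun s hs t ht hsδ htδ => ?_, fun t => ?_⟩
      · rw [← hφ.dist _ (hγ.mem s hs) (hr s hs hsδ) _ (hγ.mem t ht) (hr t ht htδ),
          hγ.dist s hs t ht]
      · rcases hφT (γ t) with h | h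
        · exact ⟨1, one_mem _, by simp [h]⟩
        · refine ⟨(unfoldMap n c i j)⁻¹, inv_mem (unfoldMap_mem_unfoldGroup i j), ?_⟩
          change γ t = (unfoldMap n c i j)⁻¹ (φ (γ t))
          rw [h, inv_apply_self]
    · obtain ⟨r, hr, hdist⟩ := hS.exists_surfDist_eq hzS
      obtain ⟨δ, hδ, hsm⟩ := small r hr
      refine ⟨δ, hδ, γ, ?_, fun t => ⟨1, one_mem _, by simp⟩⟩
      have key : ∀ s ∈ Icc (0 : ℝ) 1, ∀ t ∈ Icc (0 : ℝ) 1, |t - t₀| ≤ δ → |s - t₀| ≤ |t - t₀| →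
          ‖γ s - γ t‖ = L * |s - t| := by
        intro s hs t ht htδ hst
        refine (hγ.norm_sub_le hS hs ht).antisymm ?_
        have h1 := hdist _ (hγ.mem t ht) (hsm t ht htδ)
        rw [hγ.dist t₀ ht₀ t ht, abs_sub_comm] at h1
        have h2 := hγ.norm_sub_le hS ht₀ hs
        rw [abs_sub_comm] at h2
        have h3 := norm_sub_le_norm_sub_add_norm_sub (γ t₀) (γ s) (γ t)
        have h4 : |t - t₀| = |s - t₀| + |s - t| := by
          have : t₀ = 0 ∨ t₀ = 1 := by
            by_contra! hne
            exact hin ⟨lt_of_le_of_ne ht₀.1 hne.1.symm, lt_of_le_of_ne ht₀.2 hne.2⟩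
          rcases this with rfl | rfl
          · simp only [sub_zero, abs_of_nonneg hs.1, abs_of_nonneg ht.1] at hst ⊢
            rw [abs_sub_comm, abs_of_nonneg (by linarith)]; ring
          · have a1 : |s - 1| = 1 - s := by rw [abs_sub_comm, abs_of_nonneg]; linarith [hs.2]
            have a2 : |t - 1| = 1 - t := by rw [abs_sub_comm, abs_of_nonneg]; linarith [ht.2]
            rw [a1, a2] at hst ⊢
            rw [abs_of_nonneg (by linarith)]; ring
        have h5 : L * |t - t₀| = L * |s - t₀| + L * |s - t| := by rw [h4]; ring
        linarith
      intro s hs t ht hsδ htδ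
      rcases le_total |s - t₀| |t - t₀| with h | h
      · exact key s hs t ht htδ h
      · rw [norm_sub_rev, abs_sub_comm]; exact key t ht s hs hsδ h
  obtain ⟨ℓ, hℓ⟩ := exists_affineMap_eqOn (f := f) (L := L) (a := max 0 (t₀ - δ))
      (b := min 1 (t₀ + δ))
    (by rw [max_lt_iff, lt_min_iff, lt_min_iff]
        exact ⟨⟨by linarith, by linarith [ht₀.1]⟩, by linarith [ht₀.2], by linarith⟩) (by
      intro s hs t ht
      simp only [mem_Icc, max_le_iff, le_min_iff] at hs ht
      refine hf s ⟨hs.1.1, hs.2.1⟩ t ⟨ht.1.1, ht.2.1⟩ ?_ ?_ <;> rw [abs_le] <;> constructor <;>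
          linarith)
  refine ⟨δ, hδ, ℓ, fun t ht htδ => ?_⟩
  rw [abs_le] at htδ
  rw [hℓ t (by
    simp only [mem_Icc, max_le_iff, le_min_iff]
    refine ⟨⟨ht.1, ?_⟩, ht.2, ?_⟩ <;> linarith)]
  exact hg t

/-- A shortest path through non-warped points unfolds onto a line. -/
theorem exists_affineMap [Finite ι] [FiniteDimensional ℝ E] (hS : IsConicSurface (frontier P))
    (hγ : IsGeodesic (frontier P) v w γ) (hnw : ∀ t ∈ Ioo (0 : ℝ) 1, ¬ IsWarped n c (γ t)) :
    ∃ ℓ : ℝ →ᵃ[ℝ] E, ∀ t ∈ Icc (0 : ℝ) 1, ∃ g ∈ unfoldGroup n c, γ t = g (ℓ t) := by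
  have : Countable (unfoldGroup n c) := countable_unfoldGroup
  have hloc : ∀ t₀ : ℝ, ∃ δ > 0, ∃ ℓ : ℝ →ᵃ[ℝ] E, t₀ ∈ Icc (0 : ℝ) 1 →
      ∀ t ∈ Icc (0 : ℝ) 1, |t - t₀| ≤ δ → ∃ g ∈ unfoldGroup n c, γ t = g (ℓ t) := by
    intro t₀
    by_cases ht₀ : t₀ ∈ Icc (0 : ℝ) 1
    · obtain ⟨δ, hδ, ℓ, h⟩ := hP.exists_local_affineMap hS hγ ht₀ (hnw t₀)
      exact ⟨δ, hδ, ℓ, fun _ => h⟩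
    · exact ⟨1, one_pos, AffineMap.const ℝ ℝ 0, fun h => absurd h ht₀⟩
  choose δ hδ ℓ hℓ using hloc
  refine ⟨ℓ 0, fun t ht => ?_⟩
  have hrel : ∃ g ∈ unfoldGroup n c, ∀ u, ℓ t u = g (ℓ 0 u) := by
    refine (isPreconnected_Icc (a := (0 : ℝ)) (b := 1)).induction₂
      (fun s t => ∃ g ∈ unfoldGroup n c, ∀ u, ℓ t u = g (ℓ s u)) ?_ ?_ ?_
      (left_mem_Icc.2 zero_le_one) ht
    · intro s hs
      have hnear : ∀ᶠ t in 𝓝[Icc 0 1] s, |t - s| < δ s := by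
        refine mem_nhdsWithin_of_mem_nhds ?_
        filter_upwards [Metric.ball_mem_nhds s (hδ s)] with t ht
        rwa [mem_ball, Real.dist_eq] at ht
      filter_upwards [hnear, self_mem_nhdsWithin] with t hts htI
      rw [abs_lt] at hts
      have := hδ s
      have := hδ t
      refine exists_mem_forall_eq (γ := γ) (a := max 0 (max (s - δ s) (t - δ t)))
        (b := min 1 (min (s + δ s) (t + δ t))) ?_ (fun u hu => ?_) fun u hu => ?_
      · simp only [max_lt_iff, lt_min_iff]
        refine ⟨⟨?_, ?_, ?_⟩, ⟨?_, ?_, ?_⟩, ?_, ?_, ?_⟩ <;> linarith [hs.1, hs.2, htI.1, htI.2]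
      · simp only [mem_Icc, max_le_iff, le_min_iff] at hu
        exact hℓ s hs u ⟨hu.1.1, hu.2.1⟩ (by rw [abs_le]; constructor <;> linarith)
      · simp only [mem_Icc, max_le_iff, le_min_iff] at hu
        exact hℓ t htI u ⟨hu.1.1, hu.2.1⟩ (by rw [abs_le]; constructor <;> linarith)
    · rintro a b d - - - ⟨g, hg, h1⟩ ⟨g', hg', h2⟩
      exact ⟨g' * g, mul_mem hg' hg, fun u => by rw [h2, h1]; rfl⟩
    · rintro a b - - ⟨g, hg, h1⟩
      refine ⟨g⁻¹, inv_mem hg, fun u => ?_⟩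
      rw [h1, inv_apply_self]
  obtain ⟨g, hg, h1⟩ := hrel
  obtain ⟨g', hg', h2⟩ := hℓ t ht t ht (by rw [sub_self, abs_zero]; exact (hδ t).le)
  exact ⟨g' * g, mul_mem hg' hg, by rw [h2, h1]; rfl⟩

/-- Shortest paths from `v` to warped points lie, seen from `q`, in countably many proper
subspaces. -/
theorem exists_countable_submodules [Finite ι] [FiniteDimensional ℝ E]
    (hS : IsConicSurface (frontier P)) (v q : E) :
    ∃ 𝒲 : Set (Submodule ℝ E), 𝒲.Countable ∧ (∀ W ∈ 𝒲, W ≠ ⊤) ∧ ∀ w γ,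
      IsGeodesic (frontier P) v w γ → (∀ t ∈ Ioo (0 : ℝ) 1, ¬ IsWarped n c (γ t)) → IsWarped n c w →
        ∀ t ∈ Icc (0 : ℝ) 1, ∃ W ∈ 𝒲, γ t - q ∈ W := by
  have : Countable (unfoldGroup n c) := countable_unfoldGroup
  obtain ⟨p, hp⟩ : ∃ p : Set ι → E, ∀ w, ∀ i, ⟪n i, w⟫ = c i → ⟪n i, p {i | ⟪n i, w⟫ = c i}⟫ =
      c i := by
    have : ∀ J : Set ι, ∃ p : E, ∀ w, {i | ⟪n i, w⟫ = c i} = J → ∀ i ∈ J, ⟪n i, p⟫ = c i := by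
      intro J
      by_cases h : ∃ w, {i | ⟪n i, w⟫ = c i} = J
      · obtain ⟨w, hw⟩ := h
        exact ⟨w, fun _ _ i hi => by rw [← hw] at hi; exact hi⟩
      · exact ⟨0, fun w hw => absurd ⟨w, hw⟩ h⟩
    choose p hp using this
    exact ⟨p, fun w i hi => hp _ w rfl i hi⟩
  let U : Set ι → Submodule ℝ E := fun J => (Submodule.span ℝ (n '' J))ᗮ
  let f : unfoldGroup n c × unfoldGroup n c ×
      {J : Set ι // 3 ≤ Module.finrank ℝ (Submodule.span ℝ (n '' J))} → Submodule ℝ E := fun a =>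
    Submodule.span ℝ {a.1.1 v - q, a.2.1.1 (p a.2.2) - q} ⊔
      (U a.2.2).map (a.2.1.1.linearIsometryEquiv.toLinearEquiv : E →ₗ[ℝ] E)
  refine ⟨range f, countable_range f, ?_, ?_⟩
  · rintro _ ⟨a, rfl⟩ htop
    classical
    have h1 := Submodule.finrank_add_le_finrank_add_finrank
      (Submodule.span ℝ {a.1.1 v - q, a.2.1.1 (p a.2.2) - q})
      ((U a.2.2).map (a.2.1.1.linearIsometryEquiv.toLinearEquiv : E →ₗ[ℝ] E))
    have h2 : Module.finrank ℝ (Submodule.span ℝ {a.1.1 v - q, a.2.1.1 (p a.2.2) - q}) ≤ 2 := by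
      have := finrank_span_finset_le_card (R := ℝ) ({a.1.1 v - q, a.2.1.1 (p a.2.2) - q} : Finset E)
      rw [Finset.coe_pair] at this
      exact this.trans Finset.card_le_two
    have h3 := Submodule.finrank_map_le
      (a.2.1.1.linearIsometryEquiv.toLinearEquiv : E →ₗ[ℝ] E) (U a.2.2)
    have h4 := Submodule.finrank_add_finrank_orthogonal (Submodule.span ℝ (n '' a.2.2.1))
    have h5 := a.2.2.2
    have h6 : Module.finrank ℝ (f a) = Module.finrank ℝ E := by rw [htop, finrank_top]
    change Module.finrank ℝ (f a) ≤ _ at h1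
    rw [h6] at h1
    change _ ≤ Module.finrank ℝ ((Submodule.span ℝ (n '' a.2.2.1))ᗮ : Submodule ℝ E) at h3
    linarith
  · intro w γ hγ hnw hw t ht
    obtain ⟨ℓ, hℓ⟩ := hP.exists_affineMap hS hγ hnw
    obtain ⟨g₀, hg₀, h0⟩ := hℓ 0 (by simp)
    obtain ⟨g₁, hg₁, h1⟩ := hℓ 1 (by simp)
    obtain ⟨g, hg, ht'⟩ := hℓ t ht
    rw [hγ.zero] at h0
    rw [hγ.one] at h1
    set J : Set ι := {i | ⟪n i, w⟫ = c i} with hJ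
    set u := w - p J with hu
    have huU : u ∈ U J := by
      refine (mem_orthogonal_activeSpan_iff (n := n) (c := c) (z := w)).2 fun i hi => ?_
      rw [hu, inner_sub_right, hp w i hi, hi, sub_self]
    set h := g * g₁⁻¹ with hh
    refine ⟨_, ⟨(⟨g * g₀⁻¹, mul_mem hg (inv_mem hg₀)⟩, ⟨h, mul_mem hg (inv_mem hg₁)⟩, ⟨J, hw⟩),
        rfl⟩, ?_⟩
    have e0 : (g * g₀⁻¹) v = g (ℓ 0) := by
      rw [h0, AffineIsometryEquiv.coe_mul, Function.comp_apply, inv_apply_self]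
    have e1 : h w = g (ℓ 1) := by
      rw [h1, hh, AffineIsometryEquiv.coe_mul, Function.comp_apply, inv_apply_self]
    have e2 : h w = h.linearIsometryEquiv u + h (p J) := by
      rw [← vadd_eq_add, ← AffineIsometryEquiv.map_vadd, hu, vadd_eq_add, sub_add_cancel]
    have e3 : γ t = AffineMap.lineMap ((g * g₀⁻¹) v) (h w) t := by
      rw [ht', e0, e1]
      have : ℓ t = AffineMap.lineMap (ℓ 0) (ℓ 1) t := by
        rw [← AffineMap.apply_lineMap]; congr 1; simp [AffineMap.lineMap_apply]
      rw [this]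
      exact g.toAffineEquiv.apply_lineMap _ _ _
    have e4 : γ t - q = ((1 - t) • ((g * g₀⁻¹) v - q) + t • (h (p J) - q)) +
        t • h.linearIsometryEquiv u := by
      rw [e3, AffineMap.lineMap_apply_module, e2]; module
    rw [e4]
    refine Submodule.add_mem_sup (Submodule.add_mem _ (Submodule.smul_mem _ _ ?_)
      (Submodule.smul_mem _ _ ?_)) (Submodule.smul_mem _ _ (Submodule.mem_map_of_mem huU))
    · exact Submodule.subset_span (Or.inl rfl)
    · exact Submodule.subset_span (Or.inr rfl)

theorem exists_mem_frontier_forall_notMem [Finite ι] [FiniteDimensional ℝ E] (hq : q ∈ interior P)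
    {𝒲 : Set (Submodule ℝ E)} (hc : 𝒲.Countable) (htop : ∀ W ∈ 𝒲, W ≠ ⊤) (hw : w ∈ frontier P)
    {ε : ℝ} (hε : 0 < ε) : ∃ x ∈ frontier P, ‖x - w‖ < ε ∧ ∀ W ∈ 𝒲, x - q ∉ W := by
  have : CompleteSpace E := FiniteDimensional.complete ℝ E
  have hdense : Dense (⋂ W ∈ 𝒲, ((W : Set E)ᶜ)) := by
    refine dense_biInter_of_isOpen (fun W _ =>
        (Submodule.closed_of_finiteDimensional W).isOpen_compl) hc
      fun W hW => ?_
    rw [← interior_eq_empty_iff_dense_compl, ← not_nonempty_iff_eq_empty]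
    exact fun h => htop W hW (W.eq_top_of_nonempty_interior' h)
  set s : Set E := (Homeomorph.addLeft q) ⁻¹' P with hs
  have hsc : Convex ℝ s := hP.convex.translate_preimage_right q
  have hs0 : s ∈ 𝓝 (0 : E) := by
    refine (Homeomorph.addLeft q).continuous.continuousAt.preimage_mem_nhds ?_
    simpa using mem_interior_iff_mem_nhds.1 hq
  have hfr : ∀ u, gauge s u = 1 ↔ q + u ∈ frontier P := fun u => by
    rw [gauge_eq_one_iff_mem_frontier hsc hs0, hs, ← Homeomorph.preimage_frontier]
    rfl
  have hgw : gauge s (w - q) = 1 := (hfr _).2 (by rwa [add_sub_cancel])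
  have hgc := continuousAt_gauge (x := w - q) hsc hs0
  have hfc : ContinuousAt (fun u => q + (gauge s u)⁻¹ • u) (w - q) :=
    continuousAt_const.add ((hgc.inv₀ (by rw [hgw]; exact one_ne_zero)).smul continuousAt_id)
  have h1 : ∀ᶠ u in 𝓝 (w - q), q + (gauge s u)⁻¹ • u ∈ ball w ε := by
    refine hfc.eventually_mem ?_
    simp only [hgw, inv_one, one_smul, add_sub_cancel]
    exact ball_mem_nhds w hε
  have h2 : ∀ᶠ u in 𝓝 (w - q), 0 < gauge s u :=
    hgc.eventually_const_lt (by rw [hgw]; exact one_pos)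
  obtain ⟨u, hu, hu1, hu2⟩ := hdense.inter_nhds_nonempty (h1.and h2)
  refine ⟨_, (hfr _).1 ?_, by rwa [mem_ball, dist_eq_norm] at hu1, fun W hW hmem => ?_⟩
  · rw [gauge_smul_of_nonneg (by positivity), smul_eq_mul, inv_mul_cancel₀ hu2.ne']
  · rw [add_sub_cancel_left, Submodule.smul_mem_iff _ (by positivity)] at hmem
    exact (mem_iInter₂.1 hu W hW) hmem

end IsHPolytope
end Developing

section Closure

variable {E : Type*} [NormedAddCommGroup E] [InnerProductSpace ℝ E] {P : Set E} {ι : Type*}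
  {n : ι → E} {c : ι → ℝ} {v w x y q : E} {γ : ℝ → E}

namespace IsHPolytope

variable (hP : IsHPolytope P n c)
include hP

theorem not_isWarped_of_isGeodesic [Finite ι] [FiniteDimensional ℝ E]
    (hS : IsConicSurface (frontier P)) (hv : v ∈ frontier P) (hvw : ¬ IsWarped n c v)
    (hx : x ∈ frontier P) (hγ : IsGeodesic (frontier P) v x γ) {t : ℝ} (ht : t ∈ Ico (0 : ℝ) 1) :
    ¬ IsWarped n c (γ t) := by
  intro hw
  have htI : t ∈ Icc (0 : ℝ) 1 := ⟨ht.1, ht.2.le⟩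
  have h := hP.eq_of_isBtw_of_isWarped hS hv hvw (hγ.mem t htI) hw hx (hγ.isBtw htI)
  have h1 := hγ.dist t htI 1 (right_mem_Icc.2 zero_le_one)
  rw [← h, hγ.one, hS.surfDist_self hx, abs_sub_comm, abs_of_pos (by linarith [ht.2])] at h1
  have h2 : surfDist (frontier P) v x ≤ 0 := by
    rcases mul_eq_zero.1 h1.symm with h3 | h3
    · exact h3.le
    · linarith [ht.2]
  rw [← h, ← hS.eq_of_surfDist_le_zero hv hx h2] at hw
  exact hvw hw

theorem isFlatAt_of_isGeodesic [Finite ι] [FiniteDimensional ℝ E]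
    (hS : IsConicSurface (frontier P)) (hv : v ∈ frontier P) (hvw : ¬ IsWarped n c v)
    (hx : x ∈ frontier P) (hxw : ¬ IsWarped n c x) (hγ : IsGeodesic (frontier P) v x γ) {t : ℝ}
    (ht : t ∈ Icc (0 : ℝ) 1) : IsFlatAt (frontier P) (γ t) := by
  have hw : ¬ IsWarped n c (γ t) := by
    rcases ht.2.eq_or_lt with rfl | h
    · rwa [hγ.one]
    · exact hP.not_isWarped_of_isGeodesic hS hv hvw hx hγ ⟨ht.1, h⟩
  obtain ⟨r, φ, _, _, hφ, -⟩ := hP.exists_isFlatChart hS (hγ.mem t ht) hw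
  exact ⟨r, φ, hφ⟩

/-- Away from the cut points, a shortest path to a point not lying on any shortest path to a warped
point can be prolonged by a prescribed length. -/
theorem exists_isBtw_surfDist_eq [Finite ι] [FiniteDimensional ℝ E]
    (hS : IsConicSurface (frontier P)) (hv : v ∈ frontier P) (hvw : ¬ IsWarped n c v) {η : ℝ}
    (hη : 0 < η) (hηv : 2 * η ≤ ‖w - v‖) (hK : ∀ y, ‖y - w‖ < 2 * η → ¬ IsCutPoint P v y)
    (hx : x ∈ frontier P) (hxw : ‖x - w‖ < η)
    (hgen : ∀ y, IsWarped n c y → y ∈ frontier P → ¬ IsBtw (frontier P) v x y) :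
    ∃ y ∈ frontier P, IsBtw (frontier P) v x y ∧ surfDist (frontier P) x y = η := by
  set S := frontier P with hSdef
  set T : Set E := {y | y ∈ S ∧ surfDist S v x + surfDist S x y = surfDist S v y ∧
      surfDist S x y ≤ η}
    with hT
  have hc1 : ∀ a ∈ S, ContinuousOn (fun y => surfDist S a y) S := fun a ha =>
    hS.continuousOn_surfDist continuousOn_const continuousOn_id (fun _ _ => ha) (fun _ h => h)
  have hTc : IsCompact T := by
    have hd1 : IsClosed (S ∩ (fun y => surfDist S v x + surfDist S x y - surfDist S v y) ⁻¹' {0}) :=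
      ((continuousOn_const.add (hc1 x hx)).sub (hc1 v hv)).preimage_isClosed_of_isClosed
        hS.isCompact.isClosed isClosed_singleton
    have hd2 : IsClosed (S ∩ (fun y => surfDist S x y) ⁻¹' Iic η) :=
      (hc1 x hx).preimage_isClosed_of_isClosed hS.isCompact.isClosed isClosed_Iic
    refine hS.isCompact.of_isClosed_subset (?_ : IsClosed T) fun y hy => hy.1
    convert hd1.inter hd2 using 1
    ext y
    simp only [hT, mem_ofPred_eq, mem_inter_iff, mem_preimage, mem_singleton_iff, mem_Iic,
        sub_eq_zero]
    tauto
  have hxT : x ∈ T := ⟨hx, by rw [hS.surfDist_self hx, add_zero], by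
    rw [hS.surfDist_self hx]; exact hη.le⟩
  obtain ⟨y, hyT, hmax⟩ := hTc.exists_isMaxOn ⟨x, hxT⟩ ((hc1 x hx).mono fun y hy => hy.1)
  obtain ⟨hy, hbtw, hle⟩ := hyT
  refine ⟨y, hy, hbtw, hle.eq_or_lt.resolve_right fun hlt => ?_⟩
  have hxy : ‖y - x‖ < η := by
    rw [norm_sub_rev]; exact (hS.norm_sub_le_surfDist hx hy).trans_lt hlt
  have hyw : ‖y - w‖ < 2 * η := by
    linarith [norm_sub_le_norm_sub_add_norm_sub y x w]
  have hyW : ¬ IsWarped n c y := fun h => hgen y h hy hbtw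
  have hvy : v ≠ y := by
    rintro rfl
    rw [norm_sub_rev] at hyw
    linarith
  obtain ⟨γ, hγ⟩ := hS.exists_isGeodesic hv hy
  obtain ⟨r, hr, hdist⟩ := hS.exists_surfDist_eq hy
  obtain ⟨z, hz, hzy, hzlt, hz'⟩ := exists_isBtw_extension hS hγ
    (fun t ht => hP.isFlatAt_of_isGeodesic hS hv hvw hy hyW hγ ht) (hK y hyw) hvy
    (lt_min hr (sub_pos.2 hlt))
  rw [lt_min_iff] at hzlt
  obtain ⟨h1, h2⟩ := hS.isBtw_trans_right hv hx hy hz hbtw hz'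
  have h3 := hdist z hz hzlt.1
  rw [norm_sub_rev] at h3
  have h4 : 0 < ‖z - y‖ := norm_pos_iff.2 (sub_ne_zero.2 hzy)
  have h5 : surfDist S x y + surfDist S y z = surfDist S x z := h2
  have h6 : surfDist S x z ≤ surfDist S x y := hmax (⟨hz, h1, by linarith⟩ : z ∈ T)
  linarith

/-- Every warped point is a limit of cut points. -/
theorem mem_closure_cutPoints [Finite ι] [FiniteDimensional ℝ E]
    (hS : IsConicSurface (frontier P)) (hv : v ∈ frontier P) (hvw : ¬ IsWarped n c v)
    (hq : q ∈ interior P) (hw : w ∈ frontier P) (hww : IsWarped n c w) :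
    w ∈ closure {y | IsCutPoint P v y} := by
  by_contra hcon
  rw [Metric.mem_closure_iff] at hcon
  push Not at hcon
  obtain ⟨η₀, hη₀, hK₀⟩ := hcon
  have hwv : 0 < ‖w - v‖ := norm_pos_iff.2 (sub_ne_zero.2 fun h => hvw (h ▸ hww))
  obtain ⟨η, hη, hη1, hη2⟩ : ∃ η > 0, 2 * η ≤ η₀ ∧ 2 * η ≤ ‖w - v‖ :=
    ⟨min η₀ ‖w - v‖ / 2, by positivity, by linarith [min_le_left η₀ ‖w - v‖],
      by linarith [min_le_right η₀ ‖w - v‖]⟩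
  have hK : ∀ y, ‖y - w‖ < 2 * η → ¬ IsCutPoint P v y := fun y hy hcut => by
    have := hK₀ y hcut
    rw [dist_comm, dist_eq_norm] at this
    linarith
  obtain ⟨𝒲, h𝒲c, h𝒲t, h𝒲⟩ := hP.exists_countable_submodules hS v q
  have hx : ∀ m : ℕ, ∃ x ∈ frontier P, ‖x - w‖ < min η (1 / ((m : ℝ) + 1)) ∧ ∀ W ∈ 𝒲, x - q ∉ W :=
    fun m => hP.exists_mem_frontier_forall_notMem hq h𝒲c h𝒲t hw
      (lt_min hη Nat.one_div_pos_of_nat)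
  choose x hxS hxw hxW using hx
  have hy : ∀ m, ∃ y ∈ frontier P, IsBtw (frontier P) v (x m) y ∧
      surfDist (frontier P) (x m) y = η := by
    intro m
    refine hP.exists_isBtw_surfDist_eq hS hv hvw hη hη2 hK (hxS m)
      ((hxw m).trans_le (min_le_left _ _)) fun y hyW hyS hbtw => ?_
    obtain ⟨γ, hγ, s, hs, hsx⟩ := hS.exists_isGeodesic_through hv (hxS m) hyS hbtw
    obtain ⟨W, hW, hmem⟩ := h𝒲 y γ hγ (fun t ht =>
      hP.not_isWarped_of_isGeodesic hS hv hvw hyS hγ ⟨ht.1.le, ht.2⟩) hyW s hs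
    rw [hsx] at hmem
    exact hxW m W hW hmem
  choose y hyS hbtw hdist using hy
  obtain ⟨y', hy', σ, hσ, hlim⟩ := hS.isCompact.tendsto_subseq hyS
  have hxlim : Tendsto x atTop (𝓝 w) := by
    rw [tendsto_iff_norm_sub_tendsto_zero]
    exact squeeze_zero (fun _ => norm_nonneg _)
      (fun m => ((hxw m).trans_le (min_le_right _ _)).le) tendsto_one_div_add_atTop_nhds_zero_nat
  have hxlim' : Tendsto (fun m => x (σ m)) atTop (𝓝 w) := hxlim.comp hσ.tendsto_atTop
  have hb : IsBtw (frontier P) v w y' := hS.isBtw_of_tendsto hv (fun m => hxS (σ m))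
    (fun m => hyS (σ m)) hw hy' hxlim' hlim fun m => hbtw (σ m)
  have hd := hS.tendsto_surfDist (fun m => hxS (σ m)) (fun m => hyS (σ m)) hw hy' hxlim' hlim
  have hη' : surfDist (frontier P) w y' = η := by
    refine tendsto_nhds_unique hd ?_
    simp only [hdist]
    exact tendsto_const_nhds
  rw [hP.eq_of_isBtw_of_isWarped hS hv hvw hw hww hy' hb, hS.surfDist_self hw] at hη'
  exact hη.ne hη'

theorem closure_cutPoints_eq [Finite ι] [FiniteDimensional ℝ E]
    (hS : IsConicSurface (frontier P)) (hv : v ∈ frontier P) (hvw : ¬ IsWarped n c v) :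
    closure {y | IsCutPoint P v y} =
      {y | IsCutPoint P v y} ∪ {y | y ∈ frontier P ∧ IsWarped n c y} := by
  obtain ⟨q, hq⟩ : (interior P).Nonempty :=
    hP.exists_lt.imp fun q hq => hP.mem_interior_iff.2 hq
  refine Subset.antisymm (fun x hx => ?_) (union_subset subset_closure fun w hw =>
    hP.mem_closure_cutPoints hS hv hvw hq hw.1 hw.2)
  have hxS : x ∈ frontier P :=
    closure_minimal (fun y hy => IsCutPoint.mem_frontier hy) isClosed_frontier hx
  by_contra hcon
  have hcut : ¬ IsCutPoint P v x := fun h => hcon (Or.inl h)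
  have hxw : ¬ IsWarped n c x := fun h => hcon (Or.inr ⟨hxS, h⟩)
  obtain ⟨γ, hγ⟩ := hS.exists_isGeodesic hv hxS
  exact notMem_closure_cutPoints hS hγ
    (fun t ht => hP.isFlatAt_of_isGeodesic hS hv hvw hxS hxw hγ ht) hcut hx

end IsHPolytope
end Closure

end CutLocus

/-- Corollary 2.6, part 2: the cut locus (the closure of the set `K_v` of cut
points) equals the union of the set of cut points and the set `S_{d-2}` of
warped points (points of faces of `P` of dimension at most `d - 2`). -/
theorem closure_cutPoints_eq_cutPoints_union_warped {d : ℕ} (hd : 1 ≤ d)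
    (P : Set (EuclideanSpace ℝ (Fin (d + 1))))
    (hP : ∃ A : Finset (EuclideanSpace ℝ (Fin (d + 1))),
      P = convexHull ℝ (A : Set (EuclideanSpace ℝ (Fin (d + 1)))))
    (hint : (interior P).Nonempty)
    (v : EuclideanSpace ℝ (Fin (d + 1)))
    (hv : ∃ F : Set (EuclideanSpace ℝ (Fin (d + 1))),
      IsFace P F ∧ faceDim F = d ∧ v ∈ intrinsicInterior ℝ F) :
    closure {y : EuclideanSpace ℝ (Fin (d + 1)) | IsCutPoint P v y} =
      {y : EuclideanSpace ℝ (Fin (d + 1)) | IsCutPoint P v y} ∪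
        {y : EuclideanSpace ℝ (Fin (d + 1)) |
          ∃ F : Set (EuclideanSpace ℝ (Fin (d + 1))),
            IsFace P F ∧ faceDim F + 2 ≤ d ∧ y ∈ F} := by
  obtain ⟨A, hA⟩ := hP
  obtain ⟨ι, _, n, c, hH⟩ := CutLocus.exists_isHPolytope hA hint
  have hdim : Module.finrank ℝ (EuclideanSpace ℝ (Fin (d + 1))) = d + 1 :=
      finrank_euclideanSpace_fin
  have hS := hH.isConicSurface (by
    rw [← Module.finrank_eq_rank, hdim]
    exact_mod_cast Nat.lt_succ_of_le hd)
  obtain ⟨F, hF, hFd, hvF⟩ := hv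
  obtain ⟨hvS, hvw⟩ := hH.mem_frontier_of_intrinsicInterior hdim hF hFd hvF
  rw [hH.closure_cutPoints_eq hS hvS hvw]
  simp only [hH.exists_face_iff_isWarped hdim]
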